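/- Let α > 0. Then there exists a constant C_α > 0 such that for every u ∈ C₀^∞(B⁴) satisfying ∫_{B⁴} ((−Δ_ℍ − 9/4)((−Δ_ℍ + α)u))(x) · u(x) dV ≤ 1, one has 16 ∫_{B⁴} (e^{32π²u(x)²} − 1 − 32π²u(x)²)/(1 − |x|²)⁴ dx ≤ C_α. -/

import Mathlib

open MeasureTheory Real

noncomputable section

/-- The Euclidean space `ℝ⁴`. -/
abbrev E4 := EuclideanSpace ℝ (Fin 4)

/-- The Euclidean Laplacian on `ℝ⁴`. -/
def lapE (u : E4 → ℝ) (x : E4) : ℝ :=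
  ∑ i, fderiv ℝ (fun y => fderiv ℝ u y (EuclideanSpace.single i 1)) x (EuclideanSpace.single i 1)

/-- The hyperbolic Laplacian on the Poincaré ball `B⁴`. -/
def hypLap (u : E4 → ℝ) (x : E4) : ℝ :=
  ((1 - ‖x‖ ^ 2) / 4) * ((1 - ‖x‖ ^ 2) * lapE u x + 4 * fderiv ℝ u x x)

end

lemma volume_real_unitBall : volume.real (Metric.ball (0 : E4) 1) = π ^ 2 / 2 := by
  rw [Measure.real, InnerProductSpace.volume_ball_of_dim_even (k := 2) (by simp)]
  have : (π ^ 2 / 2 : ℝ) ≥ 0 := by positivity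
  simp [Nat.factorial, ENNReal.toReal_ofReal this]

lemma integral_radial (f : ℝ → ℝ) :
    ∫ x : E4, f ‖x‖ = 2 * π ^ 2 * ∫ r in Set.Ioi (0 : ℝ), r ^ 3 * f r := by
  rw [integral_fun_norm_addHaar, volume_real_unitBall]
  simp
  ring

lemma integrable_radial {f : ℝ → ℝ} :
    Integrable (fun x : E4 => f ‖x‖) ↔
      IntegrableOn (fun r : ℝ => r ^ 3 * f r) (Set.Ioi 0) := by
  rw [integrable_fun_norm_addHaar]
  simp

lemma setLIntegral_shell {f : ℝ → ℝ} (hf : ∀ r, 0 ≤ f r) {a R : ℝ} (ha : 0 ≤ a) (haR : a ≤ R)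
    (hfi : IntervalIntegrable (fun r => r ^ 3 * f r) volume a R) (x : E4) :
    ∫⁻ y in {y : E4 | a ≤ ‖y - x‖ ∧ ‖y - x‖ < R}, ENNReal.ofReal (f ‖y - x‖)
      = ENNReal.ofReal (2 * π ^ 2 * ∫ r in a..R, r ^ 3 * f r) := by
  have hmeas : MeasurableSet {y : E4 | a ≤ ‖y - x‖ ∧ ‖y - x‖ < R} := by
    measurability
  rw [← lintegral_indicator hmeas]
  set g : ℝ → ℝ := (Set.Ico a R).indicator f with hg
  have h1 : ∀ y : E4, ({y : E4 | a ≤ ‖y - x‖ ∧ ‖y - x‖ < R}.indicator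
      (fun y => ENNReal.ofReal (f ‖y - x‖))) y = ENNReal.ofReal (g ‖y - x‖) := by
    intro y
    by_cases hy : a ≤ ‖y - x‖ ∧ ‖y - x‖ < R
    · have : ‖y - x‖ ∈ Set.Ico a R := hy
      rw [Set.indicator_of_mem (by exact hy), hg, Set.indicator_of_mem this]
    · have : ‖y - x‖ ∉ Set.Ico a R := hy
      rw [Set.indicator_of_notMem (by exact hy), hg, Set.indicator_of_notMem this]; simp
  simp_rw [h1]
  rw [lintegral_sub_right_eq_self (fun y : E4 => ENNReal.ofReal (g ‖y‖)) x]
  have h2 : (fun r : ℝ => r ^ 3 * g r) = (Set.Ico a R).indicator (fun r => r ^ 3 * f r) := by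
    ext r
    by_cases hr : r ∈ Set.Ico a R
    · simp [hg, Set.indicator_of_mem hr]
    · simp [hg, Set.indicator_of_notMem hr]
  have h3 : IntegrableOn (fun r => r ^ 3 * f r) (Set.Ico a R) := by
    rw [integrableOn_Ico_iff_integrableOn_Ioo, ← integrableOn_Ioc_iff_integrableOn_Ioo]
    exact (intervalIntegrable_iff_integrableOn_Ioc_of_le haR).1 hfi
  have hi : Integrable (fun x : E4 => g ‖x‖) := by
    rw [integrable_radial, h2]
    exact ((integrable_indicator_iff measurableSet_Ico).2 h3).integrableOn
  rw [← ofReal_integral_eq_lintegral_ofReal hi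
    (Filter.Eventually.of_forall fun y => Set.indicator_nonneg (fun r _ => hf r) _),
    integral_radial, h2]
  congr 2
  rw [setIntegral_indicator measurableSet_Ico, intervalIntegral.integral_of_le haR]
  have h4 : (Set.Ioi 0 ∩ Set.Ico a R : Set ℝ) =ᵐ[volume] Set.Ioc a R := by
    have h5 : (Set.Ioi 0 ∩ Set.Ioc a R : Set ℝ) = Set.Ioc a R :=
      Set.inter_eq_right.2 fun r hr => lt_of_le_of_lt ha hr.1
    rw [← h5]
    exact (Filter.EventuallyEq.refl _ _).inter Ico_ae_eq_Ioc
  exact setIntegral_congr_set h4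

lemma lintegral_ball_norm_sq_inv (x : E4) {R : ℝ} (hR : 0 ≤ R) :
    ∫⁻ y in {y : E4 | ‖y - x‖ < R}, ENNReal.ofReal ((‖y - x‖ ^ 2)⁻¹)
      = ENNReal.ofReal (π ^ 2 * R ^ 2) := by
  have h : (fun r : ℝ => r ^ 3 * (r ^ 2)⁻¹) = fun r => r := by
    ext r
    rcases eq_or_ne r 0 with rfl | hr
    · simp
    · field_simp
  have := setLIntegral_shell (f := fun r => (r ^ 2)⁻¹) (fun r => by positivity) le_rfl hR
    (by rw [h]; exact intervalIntegral.intervalIntegrable_id) x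
  simp only [norm_nonneg, true_and] at this
  rw [this, h]
  congr 1
  simp
  ring

lemma lintegral_ball_norm_cube_inv (x : E4) {R : ℝ} (hR : 0 ≤ R) :
    ∫⁻ y in {y : E4 | ‖y - x‖ < R}, ENNReal.ofReal ((‖y - x‖ ^ 3)⁻¹)
      = ENNReal.ofReal (2 * π ^ 2 * R) := by
  have hc : ∀ r ∈ Set.Ioc 0 R, (fun _ => (1 : ℝ)) r = r ^ 3 * |r ^ 3|⁻¹ := by
    intro r hr
    have : 0 < r := hr.1
    rw [abs_of_pos (by positivity)]
    field_simp
  have hu : Set.uIoc 0 R = Set.Ioc 0 R := Set.uIoc_of_le hR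
  have := setLIntegral_shell (f := fun r => |r ^ 3|⁻¹) (fun r => by positivity) le_rfl hR
    ((intervalIntegrable_const (c := (1 : ℝ))).congr (by rw [hu]; exact hc)) x
  simp only [norm_nonneg, true_and, abs_pow, abs_norm] at this
  rw [this]
  congr 2
  have h2 : ∫ r in (0 : ℝ)..R, r ^ 3 * (|r| ^ 3)⁻¹ = ∫ r in (0 : ℝ)..R, (1 : ℝ) := by
    refine intervalIntegral.integral_congr_ae (Filter.Eventually.of_forall fun r hr => ?_)
    rw [hu] at hr
    rw [← abs_pow]
    exact (hc r hr).symm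
  rw [h2]
  simp

lemma lintegral_shell_norm_four_inv (x : E4) {a R : ℝ} (ha : 0 < a) (hR : a ≤ R) :
    ∫⁻ y in {y : E4 | a ≤ ‖y - x‖ ∧ ‖y - x‖ < R}, ENNReal.ofReal ((‖y - x‖ ^ 4)⁻¹)
      = ENNReal.ofReal (2 * π ^ 2 * log (R / a)) := by
  have hu : Set.uIcc a R = Set.Icc a R := Set.uIcc_of_le hR
  have hc : ∀ r ∈ Set.uIcc a R, r ^ 3 * (r ^ 4)⁻¹ = r⁻¹ := by
    intro r hr
    rw [hu] at hr
    have : 0 < r := ha.trans_le hr.1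
    field_simp
  have h0 : (0 : ℝ) ∉ Set.uIcc a R := by
    rw [hu]; exact fun h => absurd h.1 (not_le.2 ha)
  have hi : IntervalIntegrable (fun r : ℝ => r ^ 3 * (r ^ 4)⁻¹) volume a R := by
    refine ContinuousOn.intervalIntegrable ?_
    refine ContinuousOn.congr ?_ hc
    exact continuousOn_inv₀.mono fun r hr h => h0 (h ▸ hr)
  rw [setLIntegral_shell (f := fun r => (r ^ 4)⁻¹) (fun r => by positivity) ha.le hR hi x,
    intervalIntegral.integral_congr hc, integral_inv h0]

lemma lintegral_shell_norm_five_inv_le (x : E4) {a R : ℝ} (ha : 0 < a) (hR : a ≤ R) :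
    ∫⁻ y in {y : E4 | a ≤ ‖y - x‖ ∧ ‖y - x‖ < R}, ENNReal.ofReal (|‖y - x‖ ^ 5|⁻¹)
      ≤ ENNReal.ofReal (2 * π ^ 2 / a) := by
  have hu : Set.uIcc a R = Set.Icc a R := Set.uIcc_of_le hR
  have hp : ∀ r ∈ Set.uIcc a R, 0 < r := by
    intro r hr
    rw [hu] at hr
    exact ha.trans_le hr.1
  have hc : ∀ r ∈ Set.uIcc a R, r ^ 3 * |r ^ 5|⁻¹ = (r ^ 2)⁻¹ := by
    intro r hr
    have := hp r hr
    rw [abs_of_pos (by positivity)]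
    field_simp
  have hi0 : IntervalIntegrable (fun r : ℝ => (r ^ 2)⁻¹) volume a R := by
    refine ContinuousOn.intervalIntegrable ?_
    exact ContinuousOn.inv₀ (by fun_prop) fun r hr => (pow_pos (hp r hr) 2).ne'
  have hi : IntervalIntegrable (fun r : ℝ => r ^ 3 * |r ^ 5|⁻¹) volume a R :=
    hi0.congr fun r hr => (hc r (Set.uIoc_subset_uIcc hr)).symm
  rw [setLIntegral_shell (f := fun r => |r ^ 5|⁻¹) (fun r => by positivity) ha.le hR hi x,
    intervalIntegral.integral_congr hc,
    intervalIntegral.integral_eq_sub_of_hasDerivAt (f := fun r => - r⁻¹) ?_ hi0]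
  · refine ENNReal.ofReal_le_ofReal ?_
    rw [div_eq_mul_inv]
    have : 0 < R⁻¹ := inv_pos.2 (ha.trans_le hR)
    gcongr
    linarith
  · intro r hr
    have := (hasDerivAt_inv (hp r hr).ne').neg
    rw [neg_neg] at this
    exact this

/-- The normalised bubble `(2/π²)(1+|y|²)⁻³` on `ℝ⁴`. -/
noncomputable def bubble (y : E4) : ℝ := 2 / π ^ 2 * ((1 + ‖y‖ ^ 2) ^ 3)⁻¹

lemma integral_bubble : ∫ y : E4, bubble y = 1 := by
  unfold bubble
  rw [integral_radial (fun r => 2 / π ^ 2 * ((1 + r ^ 2) ^ 3)⁻¹)]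
  have hd : ∀ r ∈ Set.Ici (0 : ℝ), HasDerivAt
      (fun r : ℝ => 2 / π ^ 2 * ((1 / 4) * (r ^ 2 * (1 + r ^ 2)⁻¹) ^ 2))
      (r ^ 3 * (2 / π ^ 2 * ((1 + r ^ 2) ^ 3)⁻¹)) r := by
    intro r _
    have h1 : HasDerivAt (fun r : ℝ => r ^ 2) (2 * r) r := by simpa using hasDerivAt_pow 2 r
    have h0 : 1 + r ^ 2 ≠ 0 := by positivity
    have h2 := ((((h1.mul ((h1.const_add 1).inv h0)).pow 2).const_mul (1 / 4)).const_mul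
      (2 / π ^ 2))
    refine h2.congr_deriv ?_
    simp
    field_simp
    ring
  have hlim : Filter.Tendsto (fun r : ℝ => 2 / π ^ 2 * ((1 / 4) * (r ^ 2 * (1 + r ^ 2)⁻¹) ^ 2))
      Filter.atTop (nhds (2 / π ^ 2 * ((1 / 4) * 1 ^ 2))) := by
    have h3 : Filter.Tendsto (fun r : ℝ => r ^ 2 * (1 + r ^ 2)⁻¹) Filter.atTop (nhds 1) := by
      have h4 : Filter.Tendsto (fun r : ℝ => 1 - (1 + r ^ 2)⁻¹) Filter.atTop (nhds (1 - 0)) := by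
        refine tendsto_const_nhds.sub (Filter.Tendsto.inv_tendsto_atTop ?_)
        exact Filter.tendsto_atTop_add_const_left _ _ (Filter.tendsto_pow_atTop (by norm_num))
      rw [sub_zero] at h4
      refine h4.congr fun r => ?_
      have h0 : 1 + r ^ 2 ≠ 0 := by positivity
      field_simp
      ring
    exact ((h3.pow 2).const_mul _).const_mul _
  rw [integral_Ioi_of_hasDerivAt_of_nonneg' hd (fun r hr => ?_) hlim]
  · have := pi_pos
    field_simp
    norm_num
  · have : 0 < r := hr
    positivity

/-- The defect `1 - |x|²`. -/
noncomputable def ballDefect (x : E4) : ℝ := 1 - ‖x‖ ^ 2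

/-- The `i`-th partial derivative. -/
noncomputable def pd (i : Fin 4) (f : E4 → ℝ) (x : E4) : ℝ :=
  fderiv ℝ f x (EuclideanSpace.single i 1)

lemma ballDefect_pos {x : E4} (hx : x ∈ Metric.ball (0 : E4) 1) : 0 < ballDefect x := by
  have h : ‖x‖ < 1 := by simpa using hx
  have := norm_nonneg x
  unfold ballDefect
  nlinarith

lemma ballDefect_le_one (x : E4) : ballDefect x ≤ 1 := by
  unfold ballDefect
  have := sq_nonneg ‖x‖
  linarith

lemma contDiff_ballDefect : ContDiff ℝ (⊤ : ℕ∞) ballDefect := by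
  unfold ballDefect
  exact contDiff_const.sub (contDiff_norm_sq ℝ)

lemma continuous_ballDefect : Continuous ballDefect := contDiff_ballDefect.continuous

lemma differentiable_ballDefect : Differentiable ℝ ballDefect :=
  contDiff_ballDefect.differentiable (by simp)

lemma sum_sq_coord (x : E4) : ∑ i, x i ^ 2 = 1 - ballDefect x := by
  rw [ballDefect, EuclideanSpace.norm_sq_eq]
  simp

section PartialDerivatives

variable {f g : E4 → ℝ} {x : E4} (i : Fin 4)

lemma pd_mul (hf : DifferentiableAt ℝ f x) (hg : DifferentiableAt ℝ g x) :
    pd i (fun y => f y * g y) x = pd i f x * g x + f x * pd i g x := by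
  unfold pd
  rw [fderiv_fun_mul hf hg]
  simp
  ring

lemma pd_add (hf : DifferentiableAt ℝ f x) (hg : DifferentiableAt ℝ g x) :
    pd i (fun y => f y + g y) x = pd i f x + pd i g x := by
  unfold pd
  rw [fderiv_fun_add hf hg]
  simp

lemma pd_const_mul (c : ℝ) (hf : DifferentiableAt ℝ f x) :
    pd i (fun y => c * f y) x = c * pd i f x := by
  unfold pd
  rw [fderiv_const_mul hf]
  simp

lemma pd_comp {φ : ℝ → ℝ} {φ' : ℝ} (hφ : HasDerivAt φ φ' (f x)) (hf : DifferentiableAt ℝ f x) :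
    pd i (fun y => φ (f y)) x = φ' * pd i f x := by
  unfold pd
  have := (hφ.comp_hasFDerivAt x hf.hasFDerivAt).fderiv
  simp only [Function.comp_def] at this
  rw [this]
  simp

lemma pd_coord (j : Fin 4) (x : E4) : pd i (fun y : E4 => y j) x = if i = j then 1 else 0 := by
  unfold pd
  have : (fun y : E4 => y j) = (EuclideanSpace.proj j : E4 →L[ℝ] ℝ) := rfl
  rw [this, ContinuousLinearMap.fderiv]
  simp [eq_comm]

lemma pd_norm_sq (x : E4) : pd i (fun y : E4 => ‖y‖ ^ 2) x = 2 * x i := by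
  unfold pd
  rw [fderiv_norm_sq_apply]
  simp [EuclideanSpace.inner_single_right]

lemma pd_ballDefect (x : E4) : pd i ballDefect x = -2 * x i := by
  have : ballDefect = fun y : E4 => 1 + (-1) * ‖y‖ ^ 2 := by
    ext y; unfold ballDefect; ring
  have hd : DifferentiableAt ℝ (fun y : E4 => ‖y‖ ^ 2) x :=
    (contDiff_norm_sq ℝ (n := 1)).differentiable (by simp) x
  rw [this, pd_add _ (by fun_prop) (hd.const_mul _), pd_const_mul _ _ hd, pd_norm_sq]
  simp [pd]

lemma differentiableAt_coord (x : E4) : DifferentiableAt ℝ (fun y : E4 => y i) x :=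
  (EuclideanSpace.proj i : E4 →L[ℝ] ℝ).differentiableAt

lemma pd_div_ballDefect_pow (k : ℕ) (hf : DifferentiableAt ℝ f x) (hx : ballDefect x ≠ 0) :
    pd i (fun y => f y / ballDefect y ^ k) x
      = pd i f x / ballDefect x ^ k + 2 * k * x i * f x / ballDefect x ^ (k + 1) := by
  have h1 : HasDerivAt (fun t : ℝ => (t ^ k)⁻¹)
      (-(k * ballDefect x ^ (k - 1)) / (ballDefect x ^ k) ^ 2)
      (ballDefect x) := by
    simpa using (hasDerivAt_pow k (ballDefect x)).fun_inv (pow_ne_zero k hx)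
  have h2 := pd_comp i h1 (differentiable_ballDefect x)
  simp_rw [div_eq_mul_inv]
  rw [pd_mul (g := fun y => (ballDefect y ^ k)⁻¹) i hf
    ((differentiable_ballDefect x).pow k |>.inv (pow_ne_zero k hx)), h2,
    pd_ballDefect]
  rcases k with _ | k
  · simp
  · simp
    field_simp
    ring

end PartialDerivatives

lemma fderiv_self_eq_sum (f : E4 → ℝ) (x : E4) : fderiv ℝ f x x = ∑ i, x i * pd i f x := by
  unfold pd
  have h := congrArg (fderiv ℝ f x) ((EuclideanSpace.basisFun (Fin 4) ℝ).sum_repr x)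
  rw [map_sum] at h
  rw [← h]
  simp

lemma hypLap_eq (f : E4 → ℝ) (x : E4) :
    hypLap f x = (ballDefect x / 4) *
      (ballDefect x * ∑ i, pd i (pd i f) x + 4 * ∑ i, x i * pd i f x) := by
  unfold hypLap lapE
  rw [fderiv_self_eq_sum]
  rfl

/-- Smooth functions with compact support in the unit ball. -/
structure IsBallTest (u : E4 → ℝ) : Prop where
  smooth : ContDiff ℝ (⊤ : ℕ∞) u
  compact : HasCompactSupport u
  supp : tsupport u ⊆ Metric.ball (0 : E4) 1

namespace IsBallTest

variable {u v : E4 → ℝ}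

lemma eq_zero (hu : IsBallTest u) {x : E4} (hx : x ∉ Metric.ball (0 : E4) 1) : u x = 0 :=
  image_eq_zero_of_notMem_tsupport fun h => hx (hu.supp h)

lemma of_tsupport_subset (hu : IsBallTest u) (hv : ContDiff ℝ (⊤ : ℕ∞) v)
    (h : tsupport v ⊆ tsupport u) : IsBallTest v :=
  ⟨hv, hu.compact.mono' (subset_tsupport v |>.trans h), h.trans hu.supp⟩

lemma mul_of_contDiffAt (hu : IsBallTest u) {g : E4 → ℝ}
    (hg : ∀ x ∈ Metric.ball (0 : E4) 1, ContDiffAt ℝ (⊤ : ℕ∞) g x) :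
    IsBallTest fun x => g x * u x := by
  refine hu.of_tsupport_subset ?_ (tsupport_mul_subset_right (f := g) (g := u))
  rw [contDiff_iff_contDiffAt]
  intro x
  by_cases hx : x ∈ tsupport u
  · exact (hg x (hu.supp hx)).mul hu.smooth.contDiffAt
  · have h0 : (fun x => g x * u x) =ᶠ[nhds x] fun _ => 0 := by
      filter_upwards [(isClosed_tsupport u).isOpen_compl.mem_nhds hx] with y hy
      rw [image_eq_zero_of_notMem_tsupport hy, mul_zero]
    exact contDiffAt_const.congr_of_eventuallyEq h0

lemma smul_mul (hu : IsBallTest u) {g : E4 → ℝ} (hg : ContDiff ℝ (⊤ : ℕ∞) g) :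
    IsBallTest fun x => g x * u x :=
  hu.mul_of_contDiffAt fun _ _ => hg.contDiffAt

lemma mul (hu : IsBallTest u) (hv : IsBallTest v) : IsBallTest fun x => u x * v x :=
  hv.smul_mul hu.smooth

lemma const_mul (hu : IsBallTest u) (c : ℝ) : IsBallTest fun x => c * u x :=
  hu.smul_mul contDiff_const

lemma coord_mul (hu : IsBallTest u) (i : Fin 4) : IsBallTest fun x => x i * u x :=
  hu.smul_mul (EuclideanSpace.proj i : E4 →L[ℝ] ℝ).contDiff

lemma add (hu : IsBallTest u) (hv : IsBallTest v) : IsBallTest fun x => u x + v x := by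
  refine ⟨hu.smooth.add hv.smooth, hu.compact.add hv.compact, ?_⟩
  exact (tsupport_add u v).trans (Set.union_subset hu.supp hv.supp)

lemma sum {ι : Type*} (s : Finset ι) {w : ι → E4 → ℝ} (hw : ∀ i, IsBallTest (w i)) :
    IsBallTest fun x => ∑ i ∈ s, w i x := by
  classical
  induction s using Finset.induction_on with
  | empty =>
    simp only [Finset.sum_empty]
    exact ⟨contDiff_const, HasCompactSupport.zero, by simp [tsupport]⟩
  | insert a s ha ih =>
    simp only [Finset.sum_insert ha]
    exact (hw a).add ih

lemma div_pow (hu : IsBallTest u) (k : ℕ) : IsBallTest fun x => u x / ballDefect x ^ k := by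
  have := hu.mul_of_contDiffAt (g := fun x => (ballDefect x ^ k)⁻¹) fun x hx =>
    (contDiff_ballDefect.contDiffAt.pow k).inv (pow_pos (ballDefect_pos hx) k).ne'
  simpa only [div_eq_mul_inv, mul_comm] using this

lemma pd (hu : IsBallTest u) (i : Fin 4) : IsBallTest (pd i u) := by
  refine hu.of_tsupport_subset ?_ ?_
  · exact (hu.smooth.fderiv_right (m := (⊤ : ℕ∞)) (by simp)).clm_apply contDiff_const
  · exact tsupport_fderiv_apply_subset ℝ _

lemma integrable (hu : IsBallTest u) : Integrable u :=
  hu.smooth.continuous.integrable_of_hasCompactSupport hu.compact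

lemma differentiable (hu : IsBallTest u) : Differentiable ℝ u :=
  hu.smooth.differentiable (by simp)

lemma hypLap (hu : IsBallTest u) : IsBallTest (hypLap u) := by
  have h1 : IsBallTest fun x => ∑ i, _root_.pd i (_root_.pd i u) x :=
    sum _ fun i => (hu.pd i).pd i
  have h2 : IsBallTest fun x => ∑ i, x i * _root_.pd i u x :=
    sum _ fun i => (hu.pd i).coord_mul i
  have h3 := ((h1.smul_mul contDiff_ballDefect).add (h2.const_mul 4)).smul_mul
    (contDiff_ballDefect.div_const 4)
  have : _root_.hypLap u = _ := funext (hypLap_eq u)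
  rw [this]
  exact h3

end IsBallTest

lemma integral_pd_mul {f g : E4 → ℝ} (hf : ContDiff ℝ 1 f) (hg : ContDiff ℝ 1 g)
    (hgc : HasCompactSupport g) (i : Fin 4) :
    ∫ x, (pd i f x * g x + f x * pd i g x) = 0 := by
  have hf' : Continuous (pd i f) :=
    (hf.continuous_fderiv (by simp)).clm_apply continuous_const
  have hg' : Continuous (pd i g) :=
    (hg.continuous_fderiv (by simp)).clm_apply continuous_const
  have hgc' : HasCompactSupport (pd i g) := hgc.fderiv_apply ℝ _
  have i1 : Integrable fun x => pd i f x * g x :=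
    (hf'.mul hg.continuous).integrable_of_hasCompactSupport hgc.mul_left
  have i2 : Integrable fun x => f x * pd i g x :=
    (hf.continuous.mul hg').integrable_of_hasCompactSupport hgc'.mul_left
  have i3 : Integrable fun x => f x * g x :=
    (hf.continuous.mul hg.continuous).integrable_of_hasCompactSupport hgc.mul_left
  have := integral_mul_fderiv_eq_neg_fderiv_mul_of_integrable (μ := volume)
    (v := EuclideanSpace.single i (1 : ℝ)) i1 i2 i3
    (fun x _ => hf.differentiable (by simp) x) (fun x _ => hg.differentiable (by simp) x)
  rw [integral_add i1 i2]
  unfold pd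
  rw [this]
  ring

namespace IsBallTest

variable {u v : E4 → ℝ}

lemma mul_pd_ibp (hu : IsBallTest u) (hv : IsBallTest v) (i : Fin 4) :
    ∫ x, (_root_.pd i u x * v x + u x * _root_.pd i v x) = 0 :=
  integral_pd_mul (hu.smooth.of_le (by norm_cast)) (hv.smooth.of_le (by norm_cast)) hv.compact i

lemma integral_hypLap_mul (hu : IsBallTest u) (hv : IsBallTest v) :
    ∫ x, -_root_.hypLap u x * v x * (2 / ballDefect x) ^ 4
      = ∫ x, 4 * ∑ i, _root_.pd i u x * _root_.pd i v x / ballDefect x ^ 2 := by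
  set q : E4 → ℝ := fun x => v x / ballDefect x ^ 2 with hq
  have hqt : IsBallTest q := hv.div_pow 2
  have hL : IsBallTest fun x => -_root_.hypLap u x * v x * (2 / ballDefect x) ^ 4 := by
    have := (((hu.hypLap.mul hv).const_mul (-16)).div_pow 4)
    convert this using 2
    ring
  have hR : IsBallTest fun x => 4 * ∑ i, _root_.pd i u x * _root_.pd i v x / ballDefect x ^ 2 :=
    (sum _ fun i => ((hu.pd i).mul (hv.pd i)).div_pow 2).const_mul 4
  rw [← sub_eq_zero, ← integral_sub hL.integrable hR.integrable]
  have key : ∀ x, -_root_.hypLap u x * v x * (2 / ballDefect x) ^ 4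
      - 4 * ∑ i, _root_.pd i u x * _root_.pd i v x / ballDefect x ^ 2
      = ∑ i, -4 * (_root_.pd i (_root_.pd i u) x * q x + _root_.pd i u x * _root_.pd i q x) := by
    intro x
    by_cases hx : x ∈ Metric.ball (0 : E4) 1
    · have hd := (ballDefect_pos hx).ne'
      simp only [hq, pd_div_ballDefect_pow _ 2 (hv.differentiable x) hd, hypLap_eq]
      simp only [Fin.sum_univ_four]
      field_simp
      ring
    · simp [hv.eq_zero hx, (hv.pd _).eq_zero hx, hqt.eq_zero hx, (hqt.pd _).eq_zero hx]
  simp_rw [key]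
  rw [integral_finsetSum]
  · refine Finset.sum_eq_zero fun i _ => ?_
    rw [integral_const_mul, (hu.pd i).mul_pd_ibp hqt i, mul_zero]
  · intro i _
    exact ((((hu.pd i).pd i).mul hqt).add ((hu.pd i).mul (hqt.pd i))).const_mul (-4) |>.integrable

lemma hypLap_symm (hu : IsBallTest u) (hv : IsBallTest v) :
    ∫ x, -_root_.hypLap u x * v x * (2 / ballDefect x) ^ 4
      = ∫ x, -_root_.hypLap v x * u x * (2 / ballDefect x) ^ 4 := by
  rw [hu.integral_hypLap_mul hv, hv.integral_hypLap_mul hu]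
  simp_rw [mul_comm (_root_.pd _ u _)]

end IsBallTest

/-- The shifted operator `(-Δ_ℍ - 9/4) u`. -/
noncomputable def gapOp (u : E4 → ℝ) (x : E4) : ℝ := -hypLap u x - 9 / 4 * u x

/-- The quadratic form of `-Δ_ℍ - 9/4`. -/
noncomputable def gapForm (u : E4 → ℝ) : ℝ := ∫ x, gapOp u x * u x * (2 / ballDefect x) ^ 4

namespace IsBallTest

variable {u v : E4 → ℝ}

lemma gapOp (hu : IsBallTest u) : IsBallTest (gapOp u) := by
  have := (hu.hypLap.const_mul (-1)).add (hu.const_mul (-(9 / 4)))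
  have h : _root_.gapOp u = _ := rfl
  convert this using 1
  ext x
  unfold _root_.gapOp
  ring

lemma mul_weight (hu : IsBallTest u) : IsBallTest fun x => u x * (2 / ballDefect x) ^ 4 := by
  convert (hu.const_mul 16).div_pow 4 using 2
  ring

lemma energy_eq (hu : IsBallTest u) (α : ℝ) :
    (∫ x in Metric.ball (0 : E4) 1,
          (-(_root_.hypLap (fun y => -(_root_.hypLap u y) + α * u y) x)
            - (9 / 4) * (-(_root_.hypLap u x) + α * u x)) * u x * (2 / (1 - ‖x‖ ^ 2)) ^ 4)
      = (∫ x, _root_.gapOp u x ^ 2 * (2 / ballDefect x) ^ 4) + (9 / 4 + α) * gapForm u := by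
  set f : E4 → ℝ := fun y => -(_root_.hypLap u y) + α * u y with hf
  have hft : IsBallTest f := by
    have := (hu.hypLap.const_mul (-1)).add (hu.const_mul α)
    convert this using 2
    rw [hf]; ring
  rw [setIntegral_eq_integral_of_forall_compl_eq_zero]
  swap
  · intro x hx
    rw [hu.eq_zero hx]; ring
  have h1 : ∫ x, (-(_root_.hypLap f x) - (9 / 4) * f x) * u x * (2 / ballDefect x) ^ 4
      = (∫ x, -_root_.hypLap f x * u x * (2 / ballDefect x) ^ 4)
        + ∫ x, - (9 / 4) * f x * u x * (2 / ballDefect x) ^ 4 := by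
    rw [← integral_add]
    · congr 1; ext x; ring
    · refine (IsBallTest.integrable ?_)
      convert ((hft.hypLap.mul hu).const_mul (-1)).mul_weight using 2
      ring
    · refine (IsBallTest.integrable ?_)
      convert ((hft.mul hu).const_mul (-(9/4))).mul_weight using 2
      ring
  have h2 : (∫ x, (-(_root_.hypLap f x) - (9 / 4) * f x) * u x * (2 / (1 - ‖x‖ ^ 2)) ^ 4)
      = ∫ x, (-(_root_.hypLap f x) - (9 / 4) * f x) * u x * (2 / ballDefect x) ^ 4 := rfl
  rw [h2, h1, hft.hypLap_symm hu, ← integral_add, gapForm, ← integral_const_mul, ← integral_add]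
  · congr 1
    ext x
    simp only [_root_.gapOp, hf]
    ring
  · refine (IsBallTest.integrable ?_)
    convert (hu.gapOp.mul hu.gapOp).mul_weight using 2
    ring
  · refine (IsBallTest.integrable ?_)
    convert ((hu.gapOp.mul hu).const_mul (9 / 4 + α)).mul_weight using 2
    ring
  · refine (IsBallTest.integrable ?_)
    convert ((hu.hypLap.mul hft).const_mul (-1)).mul_weight using 2
    ring
  · refine (IsBallTest.integrable ?_)
    convert ((hft.mul hu).const_mul (-(9/4))).mul_weight using 2
    ring

end IsBallTest

lemma integral_radial_pd {G : E4 → ℝ} (hG : ContDiff ℝ 1 G) (hGc : HasCompactSupport G) :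
    ∫ x, ∑ i, x i * pd i G x = -4 * ∫ x, G x := by
  have hc : ∀ i, ContDiff ℝ 1 fun x : E4 => x i := fun i =>
    (EuclideanSpace.proj i : E4 →L[ℝ] ℝ).contDiff
  have hG' : ∀ i, Continuous (pd i G) := fun i =>
    (hG.continuous_fderiv (by simp)).clm_apply continuous_const
  have hi1 : ∀ i, Integrable fun x : E4 => x i * pd i G x := fun i =>
    ((hc i).continuous.mul (hG' i)).integrable_of_hasCompactSupport
      (hGc.fderiv_apply ℝ _).mul_left
  have hi2 : Integrable G := hG.continuous.integrable_of_hasCompactSupport hGc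
  have h : ∀ i, ∫ x : E4, x i * pd i G x = - ∫ x, G x := by
    intro i
    have := integral_pd_mul (hc i) hG hGc i
    simp only [pd_coord, if_true, one_mul] at this
    rw [integral_add hi2 (hi1 i)] at this
    linarith
  rw [integral_finsetSum _ fun i _ => hi1 i]
  simp [h]

namespace IsBallTest

variable {u : E4 → ℝ}

lemma gapForm_eq (hu : IsBallTest u) :
    gapForm u = ∫ x, (4 * ∑ i, (_root_.pd i u x + 3 * x i * u x / ballDefect x) ^ 2
        / ballDefect x ^ 2 + 12 * u x ^ 2 / ballDefect x ^ 3) := by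
  have hG : IsBallTest fun x => u x * u x / ballDefect x ^ 3 := (hu.mul hu).div_pow 3
  have hI := integral_radial_pd (hG.smooth.of_le (by norm_cast)) hG.compact
  have h1 := hu.integral_hypLap_mul hu
  have hw : IsBallTest fun x => u x * u x * (2 / ballDefect x) ^ 4 := (hu.mul hu).mul_weight
  have hL : IsBallTest fun x => -_root_.hypLap u x * u x * (2 / ballDefect x) ^ 4 := by
    convert ((hu.hypLap.mul hu).const_mul (-1)).mul_weight using 2
    ring
  have hS : IsBallTest fun x => ∑ i, x i * _root_.pd i (fun x => u x * u x / ballDefect x ^ 3) x :=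
    sum _ fun i => (hG.pd i).coord_mul i
  have hR : IsBallTest fun x => 4 * ∑ i, _root_.pd i u x * _root_.pd i u x / ballDefect x ^ 2 :=
    (sum _ fun i => ((hu.pd i).mul (hu.pd i)).div_pow 2).const_mul 4
  have h2 : gapForm u = (∫ x, 4 * ∑ i, _root_.pd i u x * _root_.pd i u x / ballDefect x ^ 2)
      - 9 / 4 * ∫ x, u x * u x * (2 / ballDefect x) ^ 4 := by
    rw [gapForm, ← h1, ← integral_const_mul, ← integral_sub hL.integrable
      (hw.const_mul (9 / 4)).integrable]
    congr 1; ext x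
    simp only [_root_.gapOp]
    ring
  have h3 : gapForm u = ∫ x, (4 * ∑ i, _root_.pd i u x * _root_.pd i u x / ballDefect x ^ 2
      - 9 / 4 * (u x * u x * (2 / ballDefect x) ^ 4)
      + 12 * (∑ i, x i * _root_.pd i (fun x => u x * u x / ballDefect x ^ 3) x
        + 4 * (u x * u x / ballDefect x ^ 3))) := by
    have hA := hR.integrable.sub (hw.const_mul (9 / 4)).integrable
    have hB := ((hS.add (hG.const_mul 4)).const_mul 12).integrable
    have hC := integral_add hA hB
    simp only [Pi.sub_apply] at hC
    have hE := integral_add hS.integrable (hG.const_mul 4).integrable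
    have hF : ∫ x, (4 : ℝ) * (u x * u x / ballDefect x ^ 3)
        = 4 * ∫ x, u x * u x / ballDefect x ^ 3 := integral_const_mul _ _
    have hH := integral_const_mul (μ := (volume : Measure E4)) (12 : ℝ)
      fun x => ∑ i, x i * _root_.pd i (fun x => u x * u x / ballDefect x ^ 3) x
        + 4 * (u x * u x / ballDefect x ^ 3)
    have hJ := integral_const_mul (μ := (volume : Measure E4)) (9 / 4 : ℝ)
      fun x => u x * u x * (2 / ballDefect x) ^ 4
    rw [hC, integral_sub hR.integrable (hw.const_mul (9 / 4)).integrable, hH, hE, hF, hI, hJ, h2]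
    ring
  rw [h3]
  congr 1
  ext x
  by_cases hx : x ∈ Metric.ball (0 : E4) 1
  · have hd := (ballDefect_pos hx).ne'
    have hs := sum_sq_coord x
    simp only [pd_div_ballDefect_pow _ 3 ((hu.mul hu).differentiable x) hd,
      pd_mul _ (hu.differentiable x) (hu.differentiable x)]
    simp only [Fin.sum_univ_four] at hs ⊢
    have hs' : x 3 ^ 2 = 1 - ballDefect x - x 0 ^ 2 - x 1 ^ 2 - x 2 ^ 2 := by linarith
    field_simp
    ring_nf
    rw [hs']
    ring
  · simp [hu.eq_zero hx, (hu.pd _).eq_zero hx, (hG.pd _).eq_zero hx]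

end IsBallTest

lemma sq_integral_mul_le {X : Type*} [MeasurableSpace X] {μ : Measure X} {f g : X → ℝ}
    (hf : Integrable (fun x => f x ^ 2) μ) (hg : Integrable (fun x => g x ^ 2) μ)
    (hfg : Integrable (fun x => f x * g x) μ) :
    (∫ x, f x * g x ∂μ) ^ 2 ≤ (∫ x, f x ^ 2 ∂μ) * ∫ x, g x ^ 2 ∂μ := by
  have h : ∀ t : ℝ, 0 ≤ (∫ x, f x ^ 2 ∂μ) * (t * t) + (2 * ∫ x, f x * g x ∂μ) * t
      + ∫ x, g x ^ 2 ∂μ := by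
    intro t
    have h0 : 0 ≤ ∫ x, (t * f x + g x) ^ 2 ∂μ := integral_nonneg fun x => sq_nonneg _
    have h1 : ∫ x, (t * f x + g x) ^ 2 ∂μ
        = ∫ x, ((t * t) * f x ^ 2 + (2 * t) * (f x * g x)) + g x ^ 2 ∂μ := by
      congr 1; ext x; ring
    have ha : Integrable (fun x => (t * t) * f x ^ 2 + (2 * t) * (f x * g x)) μ :=
      (hf.const_mul _).add (hfg.const_mul _)
    rw [h1, integral_add ha hg,
      integral_add (hf.const_mul _) (hfg.const_mul _), integral_const_mul, integral_const_mul] at h0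
    linarith
  have := discrim_le_zero h
  unfold discrim at this
  nlinarith

lemma hasDerivAt_sq_mul_abs (t : ℝ) : HasDerivAt (fun t : ℝ => t ^ 2 * |t|) (3 * t * |t|) t := by
  have h := hasDerivAt_abs_rpow t (p := 3) (by norm_num)
  have h2 : (fun x : ℝ => |x| ^ (3 : ℝ)) = fun t : ℝ => t ^ 2 * |t| := by
    ext x
    rw [← sq_abs]
    norm_cast
  rw [h2] at h
  convert h using 1
  norm_num
  ring

lemma contDiff_sq_mul_abs : ContDiff ℝ 1 (fun t : ℝ => t ^ 2 * |t|) := by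
  rw [contDiff_one_iff_deriv]
  refine ⟨fun t => (hasDerivAt_sq_mul_abs t).differentiableAt, ?_⟩
  have : deriv (fun t : ℝ => t ^ 2 * |t|) = fun t => 3 * t * |t| :=
    funext fun t => (hasDerivAt_sq_mul_abs t).deriv
  rw [this]
  fun_prop

lemma abs_coord_le_one {x : E4} (hx : x ∈ Metric.ball (0 : E4) 1) (i : Fin 4) : |x i| ≤ 1 := by
  have h := PiLp.norm_apply_le x i
  have h1 : ‖x‖ < 1 := by simpa using hx
  rw [Real.norm_eq_abs] at h
  linarith

lemma norm_fderiv_le_sum (f : E4 → ℝ) (x : E4) : ‖fderiv ℝ f x‖ ≤ ∑ i, |pd i f x| := by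
  refine ContinuousLinearMap.opNorm_le_bound _ (Finset.sum_nonneg fun _ _ => abs_nonneg _) ?_
  intro v
  have h := congrArg (fderiv ℝ f x) ((EuclideanSpace.basisFun (Fin 4) ℝ).sum_repr v)
  rw [map_sum] at h
  rw [← h, Finset.sum_mul]
  refine (norm_sum_le _ _).trans (Finset.sum_le_sum fun i _ => ?_)
  have h2 := PiLp.norm_apply_le v i
  simp only [EuclideanSpace.basisFun_repr, EuclideanSpace.basisFun_apply, map_smul, norm_smul]
  rw [mul_comm]
  exact mul_le_mul_of_nonneg_left h2 (norm_nonneg _)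

/-- The rescaled function `u / (1 - |x|²)`. -/
noncomputable def rescaled (u : E4 → ℝ) (x : E4) : ℝ := u x / ballDefect x

/-- The gradient of the rescaled function, corrected by a radial term. -/
noncomputable def corrGrad (u : E4 → ℝ) (i : Fin 4) (x : E4) : ℝ :=
  pd i (rescaled u) x + x i * (rescaled u x / ballDefect x)

namespace IsBallTest

variable {u : E4 → ℝ}

lemma rescaled (hu : IsBallTest u) : IsBallTest (rescaled u) := by
  have := hu.div_pow 1
  simp only [pow_one] at this
  exact this

lemma corrGrad (hu : IsBallTest u) (i : Fin 4) : IsBallTest (corrGrad u i) := by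
  have := (hu.rescaled.pd i).add ((hu.rescaled.div_pow 1).coord_mul i)
  simp only [pow_one] at this
  exact this

lemma gapForm_eq_rescaled (hu : IsBallTest u) :
    gapForm u = 4 * (∫ x, ∑ i, _root_.corrGrad u i x ^ 2)
      + 12 * ∫ x, _root_.rescaled u x ^ 2 / ballDefect x := by
  have h1 : IsBallTest fun x => ∑ i, _root_.corrGrad u i x ^ 2 := by
    simp only [pow_two]
    exact sum _ fun i => (hu.corrGrad i).mul (hu.corrGrad i)
  have h2 : IsBallTest fun x => _root_.rescaled u x ^ 2 / ballDefect x := by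
    have := (hu.rescaled.mul hu.rescaled).div_pow 1
    simpa only [pow_one, ← pow_two] using this
  rw [hu.gapForm_eq, ← integral_const_mul, ← integral_const_mul,
    ← integral_add (h1.const_mul 4).integrable (h2.const_mul 12).integrable]
  congr 1
  ext x
  by_cases hx : x ∈ Metric.ball (0 : E4) 1
  · have hd := (ballDefect_pos hx).ne'
    have hw : _root_.rescaled u = fun x => u x / ballDefect x ^ 1 := by
      ext x; simp [_root_.rescaled]
    simp only [_root_.corrGrad, hw, pd_div_ballDefect_pow _ 1 (hu.differentiable x) hd]
    simp only [Fin.sum_univ_four]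
    field_simp
    push_cast
    ring
  · simp [hu.eq_zero hx, (hu.pd _).eq_zero hx, (hu.corrGrad _).eq_zero hx,
      hu.rescaled.eq_zero hx]

lemma gapForm_nonneg (hu : IsBallTest u) : 0 ≤ gapForm u := by
  rw [hu.gapForm_eq_rescaled]
  have h1 : 0 ≤ ∫ x, ∑ i, _root_.corrGrad u i x ^ 2 :=
    integral_nonneg fun x => Finset.sum_nonneg fun i _ => sq_nonneg _
  have h2 : 0 ≤ ∫ x, _root_.rescaled u x ^ 2 / ballDefect x := by
    refine integral_nonneg fun x => ?_
    by_cases hx : x ∈ Metric.ball (0 : E4) 1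
    · exact div_nonneg (sq_nonneg _) (ballDefect_pos hx).le
    · simp [hu.rescaled.eq_zero hx]
  positivity

lemma abs_mul_continuous {f : E4 → ℝ} (hu : IsBallTest u) (hf : Continuous f) :
    Integrable fun x => f x * u x :=
  (hf.mul hu.smooth.continuous).integrable_of_hasCompactSupport hu.compact.mul_left

/-- The gradient term in the Sobolev inequality. -/
lemma integral_cube_div_le (hu : IsBallTest u) :
    ∫ x, _root_.rescaled u x ^ 2 * (|_root_.rescaled u x| / ballDefect x)
      ≤ 7 / 3 * (∫ x, _root_.rescaled u x ^ 2 * |_root_.rescaled u x|)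
        + ∫ x, _root_.rescaled u x ^ 2 * ∑ i, |_root_.corrGrad u i x| := by
  set w := _root_.rescaled u with hw
  have hwt : IsBallTest w := hu.rescaled
  have hG1 : ContDiff ℝ 1 fun x => w x ^ 2 * |w x| :=
    contDiff_sq_mul_abs.comp (hwt.smooth.of_le (by norm_cast))
  have hG2 : HasCompactSupport fun x => w x ^ 2 * |w x| :=
    hwt.compact.comp_left (g := fun t : ℝ => t ^ 2 * |t|) (by simp)
  have hI := integral_radial_pd hG1 hG2
  have hpd : ∀ i x, _root_.pd i (fun x => w x ^ 2 * |w x|) x = 3 * w x * |w x| * _root_.pd i w x :=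
    fun i x => pd_comp i (hasDerivAt_sq_mul_abs (w x)) (hwt.differentiable x)
  have i1 : Integrable fun x => w x ^ 2 * (|w x| / ballDefect x) := by
    have := (hwt.div_pow 1).abs_mul_continuous (f := fun x => w x * |w x|)
      (hwt.smooth.continuous.mul hwt.smooth.continuous.abs)
    refine this.congr (.of_forall fun x => ?_)
    simp only [pow_one]; ring
  have i2 : Integrable fun x => w x ^ 2 * |w x| :=
    hG1.continuous.integrable_of_hasCompactSupport hG2
  have i3 : Integrable fun x => w x ^ 2 * ∑ i, |_root_.corrGrad u i x| := by
    have := (hwt.mul hwt).abs_mul_continuous (f := fun x => ∑ i, |_root_.corrGrad u i x|)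
      (continuous_finsetSum _ fun i _ => (hu.corrGrad i).smooth.continuous.abs)
    refine this.congr (.of_forall fun x => ?_)
    simp only []; ring
  have i4 : Integrable fun x => ∑ i, x i * _root_.pd i (fun x => w x ^ 2 * |w x|) x := by
    refine integrable_finsetSum _ fun i _ => ?_
    have := ((hwt.pd i).coord_mul i).abs_mul_continuous (f := fun x => 3 * w x * |w x|)
      ((continuous_const.mul hwt.smooth.continuous).mul hwt.smooth.continuous.abs)
    refine this.congr (.of_forall fun x => ?_)
    simp only [hpd]; ring
  have i5 : Integrable fun x => 3 * (w x ^ 2 * |w x|)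
      + 3 * (w x ^ 2 * ∑ i, |_root_.corrGrad u i x|) := (i2.const_mul 3).add (i3.const_mul 3)
  have hle : ∫ x, 3 * (w x ^ 2 * (|w x| / ballDefect x)) ≤
      ∫ x, ((3 * (w x ^ 2 * |w x|) + 3 * (w x ^ 2 * ∑ i, |_root_.corrGrad u i x|))
        - ∑ i, x i * _root_.pd i (fun x => w x ^ 2 * |w x|) x) := by
    refine integral_mono (i1.const_mul 3) (i5.sub i4) ?_
    intro x
    by_cases hx : x ∈ Metric.ball (0 : E4) 1
    · have hd := ballDefect_pos hx
      have hs := sum_sq_coord x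
      simp only [hpd]
      have e1 : ∀ i, _root_.pd i w x = _root_.corrGrad u i x - x i * (w x / ballDefect x) := by
        intro i; simp only [_root_.corrGrad, ← hw]; ring
      simp only [e1]
      have e2 : ∑ i, x i * (3 * w x * |w x| * (_root_.corrGrad u i x - x i * (w x / ballDefect x)))
          = 3 * w x * |w x| * (∑ i, x i * _root_.corrGrad u i x)
            - 3 * (w x ^ 2 * |w x|) * (∑ i, x i ^ 2) / ballDefect x := by
        simp only [Fin.sum_univ_four]; ring
      rw [e2, hs]
      have e3 : |∑ i, x i * _root_.corrGrad u i x| ≤ ∑ i, |_root_.corrGrad u i x| := by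
        refine (Finset.abs_sum_le_sum_abs _ _).trans (Finset.sum_le_sum fun i _ => ?_)
        rw [abs_mul]
        exact mul_le_of_le_one_left (abs_nonneg _) (abs_coord_le_one hx i)
      have e4 : 3 * w x * |w x| * (∑ i, x i * _root_.corrGrad u i x)
          ≤ 3 * (w x ^ 2 * ∑ i, |_root_.corrGrad u i x|) := by
        refine (le_abs_self _).trans ?_
        rw [abs_mul, abs_mul, abs_mul, abs_abs, ← sq_abs (w x),
          abs_of_pos (by norm_num : (0 : ℝ) < 3)]
        have := mul_le_mul_of_nonneg_left e3 (by positivity : 0 ≤ 3 * |w x| ^ 2)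
        linarith
      have e5 : 3 * (w x ^ 2 * |w x|) * (1 - ballDefect x) / ballDefect x
          = 3 * (w x ^ 2 * (|w x| / ballDefect x)) - 3 * (w x ^ 2 * |w x|) := by
        field_simp
      rw [e5]
      linarith
    · simp [hwt.eq_zero hx, hpd]
  rw [integral_const_mul, integral_sub i5 i4, hI,
    integral_add (i2.const_mul 3) (i3.const_mul 3), integral_const_mul, integral_const_mul] at hle
  linarith

lemma integral_norm_fderiv_cube_le (hu : IsBallTest u) :
    ∫ x, ‖fderiv ℝ (fun x => _root_.rescaled u x ^ 3) x‖
      ≤ 43 * √(∫ x, _root_.rescaled u x ^ 4) * √(gapForm u) := by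
  have hmain := hu.integral_cube_div_le
  have hgap := hu.gapForm_eq_rescaled
  set w := _root_.rescaled u with hw
  have hwt : IsBallTest w := hu.rescaled
  have hcw := hwt.smooth.continuous
  have hcg : Continuous fun x => ∑ i, |_root_.corrGrad u i x| :=
    continuous_finsetSum _ fun i _ => (hu.corrGrad i).smooth.continuous.abs
  have i4 : Integrable fun x => (w x ^ 2) ^ 2 := by
    have := ((hwt.mul hwt).mul (hwt.mul hwt)).integrable
    refine this.congr (.of_forall fun x => ?_)
    simp only []; ring
  have i2 : Integrable fun x => w x ^ 2 := by
    refine (hwt.mul hwt).integrable.congr (.of_forall fun x => ?_)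
    simp only []; ring
  have i2' : Integrable fun x => |w x| ^ 2 := by simpa only [sq_abs] using i2
  have iP : Integrable fun x => w x ^ 2 * ∑ i, |_root_.corrGrad u i x| := by
    have := (hwt.mul hwt).abs_mul_continuous hcg
    refine this.congr (.of_forall fun x => ?_)
    simp only []; ring
  have iK : Integrable fun x => w x ^ 2 * |w x| := by
    have := (hwt.mul hwt).abs_mul_continuous hcw.abs
    refine this.congr (.of_forall fun x => ?_)
    simp only []; ring
  have iW : Integrable fun x => w x ^ 2 * (|w x| / ballDefect x) := by
    have := (hwt.div_pow 1).abs_mul_continuous (f := fun x => w x * |w x|) (hcw.mul hcw.abs)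
    refine this.congr (.of_forall fun x => ?_)
    simp only [pow_one]; ring
  have iz2 : Integrable fun x => ∑ i, _root_.corrGrad u i x ^ 2 := by
    simp only [pow_two]
    exact (sum _ fun i => (hu.corrGrad i).mul (hu.corrGrad i)).integrable
  have iz : Integrable fun x => (∑ i, |_root_.corrGrad u i x|) ^ 2 := by
    refine (iz2.const_mul 4).mono' (hcg.pow 2).aestronglyMeasurable (.of_forall fun x => ?_)
    rw [Real.norm_eq_abs, abs_of_nonneg (sq_nonneg _)]
    have := sq_sum_le_card_mul_sum_sq (s := Finset.univ) (f := fun i => |_root_.corrGrad u i x|)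
    simpa using this
  have id : Integrable fun x => w x ^ 2 / ballDefect x := by
    have := (hwt.mul hwt).div_pow 1
    simpa only [pow_one, ← pow_two] using this.integrable
  have hd_le : ∀ x, w x ^ 2 ≤ w x ^ 2 / ballDefect x := by
    intro x
    by_cases hx : x ∈ Metric.ball (0 : E4) 1
    · exact le_div_self (sq_nonneg _) (ballDefect_pos hx) (ballDefect_le_one x)
    · simp [hwt.eq_zero hx]
  have hz0 : 0 ≤ ∫ x, ∑ i, _root_.corrGrad u i x ^ 2 :=
    integral_nonneg fun x => Finset.sum_nonneg fun i _ => sq_nonneg _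
  have hww : ∫ x, w x ^ 2 ≤ ∫ x, w x ^ 2 / ballDefect x := integral_mono i2 id hd_le
  have hw0 : 0 ≤ ∫ x, w x ^ 2 := integral_nonneg fun x => sq_nonneg _
  have hz : ∫ x, (∑ i, |_root_.corrGrad u i x|) ^ 2 ≤ 4 * ∫ x, ∑ i, _root_.corrGrad u i x ^ 2 := by
    rw [← integral_const_mul]
    refine integral_mono iz (iz2.const_mul 4) fun x => ?_
    have := sq_sum_le_card_mul_sum_sq (s := Finset.univ) (f := fun i => |_root_.corrGrad u i x|)
    simpa using this
  have e44 : ∫ x, (w x ^ 2) ^ 2 = ∫ x, w x ^ 4 := by congr 1; ext x; ring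
  have hX0 : 0 ≤ ∫ x, w x ^ 4 := integral_nonneg fun x => by positivity
  have hP : ∫ x, w x ^ 2 * ∑ i, |_root_.corrGrad u i x|
      ≤ √(∫ x, w x ^ 4) * √(gapForm u) := by
    rw [← Real.sqrt_mul hX0]
    refine Real.le_sqrt_of_sq_le ((sq_integral_mul_le i4 iz iP).trans ?_)
    rw [e44]
    refine mul_le_mul_of_nonneg_left ?_ hX0
    linarith
  have hK : ∫ x, w x ^ 2 * |w x| ≤ √(∫ x, w x ^ 4) * √(gapForm u) := by
    rw [← Real.sqrt_mul hX0]
    refine Real.le_sqrt_of_sq_le ((sq_integral_mul_le i4 i2' iK).trans ?_)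
    rw [e44]
    simp only [sq_abs]
    refine mul_le_mul_of_nonneg_left ?_ hX0
    linarith
  have hpt : ∀ x, ‖fderiv ℝ (fun x => w x ^ 3) x‖ ≤
      3 * (w x ^ 2 * ∑ i, |_root_.corrGrad u i x|) + 12 * (w x ^ 2 * (|w x| / ballDefect x)) := by
    intro x
    refine (norm_fderiv_le_sum _ x).trans ?_
    have hpd : ∀ i, _root_.pd i (fun x => w x ^ 3) x = 3 * w x ^ 2 * _root_.pd i w x := by
      intro i
      have := pd_comp i (hasDerivAt_pow 3 (w x)) (hwt.differentiable x)
      simpa using this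
    simp only [hpd]
    by_cases hx : x ∈ Metric.ball (0 : E4) 1
    · have hd := ballDefect_pos hx
      have e1 : ∀ i, |3 * w x ^ 2 * _root_.pd i w x| ≤
          3 * w x ^ 2 * (|_root_.corrGrad u i x| + |w x| / ballDefect x) := by
        intro i
        rw [abs_mul, abs_of_nonneg (by positivity : 0 ≤ 3 * w x ^ 2)]
        refine mul_le_mul_of_nonneg_left ?_ (by positivity)
        have e0 : _root_.pd i w x = _root_.corrGrad u i x - x i * (w x / ballDefect x) := by
          simp only [_root_.corrGrad, ← hw]; ring
        rw [e0]
        refine (abs_sub _ _).trans (add_le_add le_rfl ?_)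
        rw [abs_mul, abs_div, abs_of_pos hd]
        exact mul_le_of_le_one_left (by positivity) (abs_coord_le_one hx i)
      refine (Finset.sum_le_sum fun i _ => e1 i).trans (le_of_eq ?_)
      simp only [Fin.sum_univ_four]
      ring
    · simp [hwt.eq_zero hx]
  have hle := integral_mono_of_nonneg (.of_forall fun x => norm_nonneg _)
    ((iP.const_mul 3).add (iW.const_mul 12)) (.of_forall hpt)
  simp only [Pi.add_apply] at hle
  rw [integral_add (iP.const_mul 3) (iW.const_mul 12), integral_const_mul,
    integral_const_mul] at hle
  linarith

end IsBallTest

lemma exists_sobolev_const :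
    ∃ C : ℝ, 0 < C ∧ ∀ u : E4 → ℝ, IsBallTest u →
      ∫ x, (u x / ballDefect x) ^ 4 ≤ C * gapForm u ^ 2 := by
  set c : ℝ := (lintegralPowLePowLIntegralFDerivConst (volume : Measure E4) (4 / 3) : ℝ) with hc
  have hc0 : 0 ≤ c := NNReal.coe_nonneg _
  refine ⟨(c + 1) ^ 3 * 43 ^ 4, by positivity, fun u hu => ?_⟩
  have hcube : IsBallTest fun x => rescaled u x ^ 3 := by
    convert hu.rescaled.mul (hu.rescaled.mul hu.rescaled) using 2
    ring
  have hG := lintegral_pow_le_pow_lintegral_fderiv (volume : Measure E4) (p := 4 / 3)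
    (hcube.smooth.of_le (by norm_cast)) hcube.compact (by
      rw [finrank_euclideanSpace_fin, Real.holderConjugate_iff]
      norm_num)
  have hN := hu.integral_norm_fderiv_cube_le
  set X := ∫ x, rescaled u x ^ 4 with hX
  have hX0 : 0 ≤ X := integral_nonneg fun x => by positivity
  have hD0 := hu.gapForm_nonneg
  set N := ∫ x, ‖fderiv ℝ (fun x => rescaled u x ^ 3) x‖ with hNdef
  have hN0 : 0 ≤ N := integral_nonneg fun x => norm_nonneg _
  have i4 : Integrable fun x => rescaled u x ^ 4 := by
    have := (hu.rescaled.mul hcube).integrable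
    refine this.congr (.of_forall fun x => ?_)
    simp only []; ring
  have e1 : ∫⁻ x, ‖rescaled u x ^ 3‖ₑ ^ (4 / 3 : ℝ) = ENNReal.ofReal X := by
    rw [hX, ofReal_integral_eq_lintegral_ofReal i4
      (.of_forall fun x => (show Even 4 by decide).pow_nonneg _)]
    congr 1; ext x
    rw [Real.enorm_eq_ofReal_abs, ENNReal.ofReal_rpow_of_nonneg (abs_nonneg _) (by norm_num),
      abs_pow, ← Real.rpow_natCast, ← Real.rpow_mul (abs_nonneg _)]
    congr 1
    norm_num
    rw [← abs_pow, abs_of_nonneg ((show Even 4 by decide).pow_nonneg _)]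
  have iN : Integrable fun x => fderiv ℝ (fun x => rescaled u x ^ 3) x :=
    (hcube.smooth.continuous_fderiv (by simp)).integrable_of_hasCompactSupport
      (hcube.compact.fderiv ℝ)
  have e2 : ∫⁻ x, ‖fderiv ℝ (fun x => rescaled u x ^ 3) x‖ₑ = ENNReal.ofReal N :=
    (ofReal_integral_norm_eq_lintegral_enorm iN).symm
  rw [e1, e2, ENNReal.ofReal_rpow_of_nonneg hN0 (by norm_num), ← ENNReal.ofReal_coe_nnreal,
    ← ENNReal.ofReal_mul hc0,
    ENNReal.ofReal_le_ofReal_iff (mul_nonneg hc0 (Real.rpow_nonneg hN0 _))] at hG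
  have h3 : X ^ 3 ≤ (c + 1) ^ 3 * N ^ 4 := by
    have := pow_le_pow_left₀ hX0 hG 3
    rw [mul_pow, ← Real.rpow_natCast (N ^ _), ← Real.rpow_mul hN0] at this
    norm_num at this
    refine this.trans ?_
    have h5 : c ^ 3 ≤ (c + 1) ^ 3 := pow_le_pow_left₀ hc0 (by linarith) 3
    norm_cast at this ⊢
    exact mul_le_mul_of_nonneg_right (by exact_mod_cast h5) (by positivity)
  have h4 : N ^ 4 ≤ 43 ^ 4 * X ^ 2 * gapForm u ^ 2 := by
    have := pow_le_pow_left₀ hN0 hN 4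
    rw [mul_pow, mul_pow] at this
    have a1 : √X ^ 4 = X ^ 2 := by
      rw [show 4 = 2 * 2 from rfl, pow_mul, Real.sq_sqrt hX0]
    have a2 : √(gapForm u) ^ 4 = gapForm u ^ 2 := by
      rw [show 4 = 2 * 2 from rfl, pow_mul, Real.sq_sqrt hD0]
    rwa [a1, a2] at this
  change X ≤ _
  rcases hX0.eq_or_lt with h0 | h0
  · rw [← h0]; positivity
  · have h5 : X ^ 2 * X ≤ X ^ 2 * ((c + 1) ^ 3 * 43 ^ 4 * gapForm u ^ 2) := by
      calc X ^ 2 * X = X ^ 3 := by ring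
        _ ≤ _ := h3
        _ ≤ (c + 1) ^ 3 * (43 ^ 4 * X ^ 2 * gapForm u ^ 2) :=
          mul_le_mul_of_nonneg_left h4 (by positivity)
        _ = _ := by ring
    exact le_of_mul_le_mul_left h5 (by positivity)

/-- A smooth cutoff in the squared radius. -/
noncomputable def cutoff (s : ℝ) : ℝ := Real.smoothTransition (1 - s)

lemma contDiff_cutoff : ContDiff ℝ (⊤ : ℕ∞) cutoff :=
  Real.smoothTransition.contDiff.comp (contDiff_const.sub contDiff_id)

lemma cutoff_nonneg (s : ℝ) : 0 ≤ cutoff s := Real.smoothTransition.nonneg _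

lemma cutoff_le_one (s : ℝ) : cutoff s ≤ 1 := Real.smoothTransition.le_one _

lemma cutoff_zero : cutoff 0 = 1 := Real.smoothTransition.one_of_one_le (by norm_num)

lemma cutoff_eq_zero {s : ℝ} (hs : 1 ≤ s) : cutoff s = 0 :=
  Real.smoothTransition.zero_of_nonpos (by linarith)

lemma hasDerivAt_cutoff (s : ℝ) : HasDerivAt cutoff (deriv cutoff s) s :=
  (contDiff_cutoff.differentiable (by simp) s).hasDerivAt

lemma contDiff_deriv_cutoff : ContDiff ℝ (⊤ : ℕ∞) (deriv cutoff) :=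
  (contDiff_infty_iff_deriv.1 contDiff_cutoff).2

lemma hasDerivAt_deriv_cutoff (s : ℝ) :
    HasDerivAt (deriv cutoff) (deriv (deriv cutoff) s) s :=
  (contDiff_deriv_cutoff.differentiable (by simp) s).hasDerivAt

lemma deriv_cutoff_eq_zero {s : ℝ} (hs : 1 < s) : deriv cutoff s = 0 := by
  have : cutoff =ᶠ[nhds s] fun _ => 0 := by
    filter_upwards [lt_mem_nhds hs] with t ht using cutoff_eq_zero ht.le
  rw [this.deriv_eq, deriv_const]

lemma deriv_deriv_cutoff_eq_zero {s : ℝ} (hs : 1 < s) : deriv (deriv cutoff) s = 0 := by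
  have : deriv cutoff =ᶠ[nhds s] fun _ => 0 := by
    filter_upwards [lt_mem_nhds hs] with t ht using deriv_cutoff_eq_zero ht
  rw [this.deriv_eq, deriv_const]

lemma exists_cutoff_deriv_bound :
    ∃ K : ℝ, 0 ≤ K ∧ ∀ s ∈ Set.Icc (0 : ℝ) 1,
      |deriv cutoff s| ≤ K ∧ |deriv (deriv cutoff) s| ≤ K := by
  obtain ⟨K1, h1⟩ := isCompact_Icc.exists_bound_of_continuousOn (s := Set.Icc (0 : ℝ) 1)
    contDiff_deriv_cutoff.continuous.continuousOn
  obtain ⟨K2, h2⟩ := isCompact_Icc.exists_bound_of_continuousOn (s := Set.Icc (0 : ℝ) 1)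
    (contDiff_infty_iff_deriv.1 contDiff_deriv_cutoff).2.continuous.continuousOn
  refine ⟨max 0 (max K1 K2), le_max_left _ _, fun s hs => ⟨?_, ?_⟩⟩
  · exact (h1 s hs).trans ((le_max_left _ _).trans (le_max_right _ _))
  · exact (h2 s hs).trans ((le_max_right _ _).trans (le_max_right _ _))

/-- The truncated, regularised fundamental solution. -/
noncomputable def regFund (e : ℝ) (x : E4) : ℝ := cutoff (‖x‖ ^ 2) * (‖x‖ ^ 2 + e)⁻¹

lemma contDiff_regFund {e : ℝ} (he : 0 < e) : ContDiff ℝ (⊤ : ℕ∞) (regFund e) := by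
  unfold regFund
  refine (contDiff_cutoff.comp (contDiff_norm_sq ℝ)).mul
    (((contDiff_norm_sq ℝ).add contDiff_const).inv fun x => ?_)
  positivity

/-- The error term in the Laplacian of `regFund`. -/
noncomputable def regFundError (e s : ℝ) : ℝ :=
  4 * s * deriv (deriv cutoff) s / (s + e) - 8 * s * deriv cutoff s / (s + e) ^ 2
    + 8 * deriv cutoff s / (s + e)

lemma sum_pd_pd_regFund {e : ℝ} (he : 0 < e) (x : E4) :
    ∑ i, pd i (pd i (regFund e)) x
      = regFundError e (‖x‖ ^ 2) - 8 * e * cutoff (‖x‖ ^ 2) / (‖x‖ ^ 2 + e) ^ 3 := by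
  have hpos : ∀ y : E4, ‖y‖ ^ 2 + e ≠ 0 := fun y => by positivity
  have hd : ∀ y : E4, DifferentiableAt ℝ (fun y : E4 => ‖y‖ ^ 2) y := fun y =>
    (contDiff_norm_sq ℝ (n := 1)).differentiable (by simp) y
  set f1 : ℝ → ℝ := fun s => deriv cutoff s * (s + e)⁻¹ - cutoff s * ((s + e) ^ 2)⁻¹ with hf1
  have hinv : ∀ s : ℝ, s + e ≠ 0 → HasDerivAt (fun s => (s + e)⁻¹) (-((s + e) ^ 2)⁻¹) s := by
    intro s hs
    have := ((hasDerivAt_id s).add_const e).fun_inv hs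
    simpa [neg_div] using this
  have hinv2 : ∀ s : ℝ, s + e ≠ 0 →
      HasDerivAt (fun s => ((s + e) ^ 2)⁻¹) (-2 * ((s + e) ^ 3)⁻¹) s := by
    intro s hs
    have := (((hasDerivAt_id s).add_const e).fun_pow 2).fun_inv (pow_ne_zero 2 hs)
    refine this.congr_deriv ?_
    simp
    field_simp
  have h1 : ∀ s : ℝ, s + e ≠ 0 → HasDerivAt (fun s => cutoff s * (s + e)⁻¹) (f1 s) s := by
    intro s hs
    refine ((hasDerivAt_cutoff s).mul (hinv s hs)).congr_deriv ?_
    simp only [hf1]; ring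
  have h2 : ∀ s : ℝ, s + e ≠ 0 → HasDerivAt f1
      (deriv (deriv cutoff) s * (s + e)⁻¹ - 2 * deriv cutoff s * ((s + e) ^ 2)⁻¹
        + 2 * cutoff s * ((s + e) ^ 3)⁻¹) s := by
    intro s hs
    refine (((hasDerivAt_deriv_cutoff s).mul (hinv s hs)).sub
      ((hasDerivAt_cutoff s).mul (hinv2 s hs))).congr_deriv ?_
    ring
  have p1 : ∀ i, pd i (regFund e) = fun y => f1 (‖y‖ ^ 2) * (2 * y i) := by
    intro i
    ext y
    have := pd_comp i (h1 _ (hpos y)) (hd y)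
    rw [pd_norm_sq] at this
    exact this
  have p2 : ∀ i, pd i (pd i (regFund e)) x = (deriv (deriv cutoff) (‖x‖ ^ 2) * (‖x‖ ^ 2 + e)⁻¹
      - 2 * deriv cutoff (‖x‖ ^ 2) * ((‖x‖ ^ 2 + e) ^ 2)⁻¹
        + 2 * cutoff (‖x‖ ^ 2) * ((‖x‖ ^ 2 + e) ^ 3)⁻¹) * (2 * x i) * (2 * x i)
        + f1 (‖x‖ ^ 2) * 2 := by
    intro i
    have q := pd_comp i (h2 _ (hpos x)) (hd x)
    rw [pd_norm_sq] at q
    rw [p1, pd_mul (f := fun y => f1 (‖y‖ ^ 2)) i (((h2 _ (hpos x)).differentiableAt).comp x (hd x))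
      ((differentiableAt_coord i x).const_mul 2), q,
      pd_const_mul i _ (differentiableAt_coord i x), pd_coord]
    simp
  simp only [p2]
  have hs : ‖x‖ ^ 2 = x 0 ^ 2 + x 1 ^ 2 + x 2 ^ 2 + x 3 ^ 2 := by
    rw [EuclideanSpace.norm_sq_eq]
    simp [Fin.sum_univ_four]
  have e1 : ∀ a b : ℝ, ∑ i, (a * (2 * x i) * (2 * x i) + b * 2) = 4 * a * ‖x‖ ^ 2 + 8 * b := by
    intro a b
    rw [hs]
    simp only [Fin.sum_univ_four]
    ring
  rw [e1]
  have := hpos x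
  simp only [hf1, regFundError]
  field_simp
  ring

lemma abs_regFundError_le {e K s : ℝ} (he : 0 < e) (hs : 0 < s) (hs1 : s ≤ 1)
    (h1 : |deriv cutoff s| ≤ K) (h2 : |deriv (deriv cutoff) s| ≤ K) :
    |regFundError e s| ≤ 20 * K * s⁻¹ := by
  have hK : 0 ≤ K := (abs_nonneg _).trans h1
  have hse : 0 < s + e := by positivity
  have a0 : (s + e)⁻¹ ≤ s⁻¹ := inv_anti₀ hs (by linarith)
  have a1 : s * (s + e)⁻¹ ≤ 1 := by
    rw [← div_eq_mul_inv, div_le_one hse]; linarith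
  have a2 : 1 ≤ s⁻¹ := one_le_inv_iff₀.2 ⟨hs, hs1⟩
  have a3 : 0 ≤ (s + e)⁻¹ := by positivity
  have b1 : |4 * s * deriv (deriv cutoff) s / (s + e)| ≤ 4 * K * s⁻¹ := by
    rw [show 4 * s * deriv (deriv cutoff) s / (s + e)
      = 4 * deriv (deriv cutoff) s * (s * (s + e)⁻¹) by rw [div_eq_mul_inv]; ring,
      abs_mul, abs_mul, abs_of_pos (by norm_num : (0:ℝ) < 4), abs_of_nonneg (by positivity :
        0 ≤ s * (s + e)⁻¹)]
    exact mul_le_mul (by linarith) (a1.trans a2) (by positivity) (by positivity)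
  have b2 : |8 * s * deriv cutoff s / (s + e) ^ 2| ≤ 8 * K * s⁻¹ := by
    rw [show 8 * s * deriv cutoff s / (s + e) ^ 2
      = 8 * deriv cutoff s * (s * (s + e)⁻¹ * (s + e)⁻¹) by field_simp,
      abs_mul, abs_mul, abs_of_pos (by norm_num : (0:ℝ) < 8), abs_of_nonneg (by positivity :
        0 ≤ s * (s + e)⁻¹ * (s + e)⁻¹)]
    refine mul_le_mul (by linarith) ?_ (by positivity) (by positivity)
    exact (mul_le_of_le_one_left a3 a1).trans a0
  have b3 : |8 * deriv cutoff s / (s + e)| ≤ 8 * K * s⁻¹ := by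
    rw [div_eq_mul_inv, abs_mul, abs_mul, abs_of_pos (by norm_num : (0:ℝ) < 8), abs_of_nonneg a3]
    exact mul_le_mul (by linarith) a0 (by positivity) (by positivity)
  unfold regFundError
  have t1 := abs_add_le (4 * s * deriv (deriv cutoff) s / (s + e)
    - 8 * s * deriv cutoff s / (s + e) ^ 2) (8 * deriv cutoff s / (s + e))
  have t2 := abs_sub (4 * s * deriv (deriv cutoff) s / (s + e))
    (8 * s * deriv cutoff s / (s + e) ^ 2)
  linarith

lemma integral_mul_lapE {φ V : E4 → ℝ} (hφ : ContDiff ℝ (⊤ : ℕ∞) φ) (hV : ContDiff ℝ (⊤ : ℕ∞) V)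
    (hVc : HasCompactSupport V) :
    ∫ x, φ x * lapE V x = ∫ x, (∑ i, pd i (pd i φ) x) * V x := by
  have hp : ∀ {f : E4 → ℝ}, ContDiff ℝ (⊤ : ℕ∞) f → ∀ i, ContDiff ℝ (⊤ : ℕ∞) (pd i f) :=
    fun hf i => (hf.fderiv_right (m := (⊤ : ℕ∞)) (by simp)).clm_apply contDiff_const
  have hc : ∀ {f : E4 → ℝ}, HasCompactSupport f → ∀ i, HasCompactSupport (pd i f) :=
    fun hf i => hf.fderiv_apply ℝ _
  have j1 : ∀ i, Integrable fun x => φ x * pd i (pd i V) x := fun i =>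
    (hφ.continuous.mul (hp (hp hV i) i).continuous).integrable_of_hasCompactSupport
      (hc (hc hVc i) i).mul_left
  have j2 : ∀ i, Integrable fun x => pd i φ x * pd i V x := fun i =>
    ((hp hφ i).continuous.mul (hp hV i).continuous).integrable_of_hasCompactSupport
      (hc hVc i).mul_left
  have j3 : ∀ i, Integrable fun x => pd i (pd i φ) x * V x := fun i =>
    ((hp (hp hφ i) i).continuous.mul hV.continuous).integrable_of_hasCompactSupport hVc.mul_left
  have key : ∀ i, ∫ x, φ x * pd i (pd i V) x = ∫ x, pd i (pd i φ) x * V x := by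
    intro i
    have a := integral_pd_mul (hφ.of_le (by norm_cast)) ((hp hV i).of_le (by norm_cast))
      (hc hVc i) i
    have b := integral_pd_mul ((hp hφ i).of_le (by norm_cast)) (hV.of_le (by norm_cast)) hVc i
    rw [integral_add (j2 i) (j1 i)] at a
    rw [integral_add (j3 i) (j2 i)] at b
    linarith
  have l : ∀ x, φ x * lapE V x = ∑ i, φ x * pd i (pd i V) x := by
    intro x
    rw [← Finset.mul_sum]
    rfl
  simp_rw [l, Finset.sum_mul]
  rw [integral_finsetSum _ fun i _ => j1 i, integral_finsetSum _ fun i _ => j3 i]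
  exact Finset.sum_congr rfl fun i _ => key i

lemma tendsto_integral_bubble {g : E4 → ℝ} (hg : Continuous g) (hgc : HasCompactSupport g) :
    Filter.Tendsto (fun c : ℝ => ∫ x, (c ^ 4 * bubble (c • x)) * g x) Filter.atTop
      (nhds (g 0)) := by
  have hb : ∀ x, 0 ≤ bubble x := fun x => by unfold bubble; positivity
  have h := tendsto_integral_comp_smul_smul_of_integrable (μ := (volume : Measure E4)) hb
    integral_bubble ?_ (hg.integrable_of_hasCompactSupport hgc) hg.continuousAt
  · simpa [finrank_euclideanSpace_fin, mul_assoc] using h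
  · rw [finrank_euclideanSpace_fin]
    have h1 : Filter.Tendsto (fun x : E4 => 2 / π ^ 2 * (‖x‖ ^ 2)⁻¹)
        (Bornology.cobounded E4) (nhds (2 / π ^ 2 * 0)) := by
      refine Filter.Tendsto.const_mul _ ?_
      exact tendsto_inv_atTop_zero.comp
        ((Filter.tendsto_pow_atTop (by norm_num)).comp tendsto_norm_cobounded_atTop)
    rw [mul_zero] at h1
    refine tendsto_of_tendsto_of_tendsto_of_le_of_le' tendsto_const_nhds h1
      (.of_forall fun x => mul_nonneg (by positivity) (hb x)) ?_
    filter_upwards [tendsto_norm_cobounded_atTop.eventually_ge_atTop 1] with x hx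
    unfold bubble
    rw [mul_left_comm]
    refine mul_le_mul_of_nonneg_left ?_ (by positivity)
    have hx0 : 0 < ‖x‖ := by linarith
    rw [← div_eq_mul_inv, div_le_iff₀ (by positivity), inv_mul_eq_div, le_div_iff₀ (by positivity)]
    have : (‖x‖ ^ 2) ^ 3 ≤ (1 + ‖x‖ ^ 2) ^ 3 := pow_le_pow_left₀ (by positivity) (by linarith) 3
    calc ‖x‖ ^ 4 * ‖x‖ ^ 2 = (‖x‖ ^ 2) ^ 3 := by ring
      _ ≤ _ := this

/-- A local representation inequality at the origin. -/
lemma exists_local_representation :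
    ∃ K : ℝ, 0 ≤ K ∧ ∀ V : E4 → ℝ, ContDiff ℝ (⊤ : ℕ∞) V → HasCompactSupport V →
      ENNReal.ofReal (4 * π ^ 2 * |V 0|) ≤
        ∫⁻ x in {x : E4 | ‖x‖ < 1},
          ENNReal.ofReal ((‖x‖ ^ 2)⁻¹ * (|lapE V x| + K * |V x|)) := by
  obtain ⟨K, hK, hb⟩ := exists_cutoff_deriv_bound
  refine ⟨20 * K, by positivity, fun V hV hVc => ?_⟩
  have hg : Continuous fun x => cutoff (‖x‖ ^ 2) * V x :=
    (contDiff_cutoff.continuous.comp (continuous_norm.pow 2)).mul hV.continuous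
  have ht := tendsto_integral_bubble hg hVc.mul_left
  have ht2 := (ENNReal.continuous_ofReal.tendsto _).comp ((ht.const_mul (4 * π ^ 2)).abs)
  have hlim : ENNReal.ofReal |4 * π ^ 2 * (cutoff (‖(0 : E4)‖ ^ 2) * V 0)|
      = ENNReal.ofReal (4 * π ^ 2 * |V 0|) := by
    rw [norm_zero, zero_pow two_ne_zero, cutoff_zero, one_mul, abs_mul,
      abs_of_pos (by positivity : 0 < 4 * π ^ 2)]
  rw [hlim] at ht2
  refine le_of_tendsto ht2 ?_
  filter_upwards [Filter.eventually_gt_atTop 0] with c hc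
  simp only [Function.comp]
  set e : ℝ := (c ^ 2)⁻¹ with he
  have he0 : 0 < e := by positivity
  have hφ := contDiff_regFund he0
  have hlapc : Continuous (lapE V) := by
    have hp : ∀ {f : E4 → ℝ}, ContDiff ℝ (⊤ : ℕ∞) f → ∀ i, ContDiff ℝ (⊤ : ℕ∞) (pd i f) :=
      fun hf i => (hf.fderiv_right (m := (⊤ : ℕ∞)) (by simp)).clm_apply contDiff_const
    exact continuous_finsetSum _ fun i _ => (hp (hp hV i) i).continuous
  have hlaps : HasCompactSupport (lapE V) := by
    have : ∀ i, HasCompactSupport (pd i (pd i V)) := fun i =>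
      (hVc.fderiv_apply ℝ _).fderiv_apply ℝ _
    have h4 := (((this 0).add (this 1)).add (this 2)).add (this 3)
    have h5 : lapE V = pd 0 (pd 0 V) + pd 1 (pd 1 V) + pd 2 (pd 2 V) + pd 3 (pd 3 V) := by
      ext x
      simp only [lapE, Fin.sum_univ_four]
      rfl
    rwa [h5]
  have hp : ∀ {f : E4 → ℝ}, ContDiff ℝ (⊤ : ℕ∞) f → ∀ i, ContDiff ℝ (⊤ : ℕ∞) (pd i f) :=
    fun hf i => (hf.fderiv_right (m := (⊤ : ℕ∞)) (by simp)).clm_apply contDiff_const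
  have hcl : Continuous fun x => ∑ i, pd i (pd i (regFund e)) x :=
    continuous_finsetSum _ fun i _ => (hp (hp hφ i) i).continuous
  have i1 : Integrable fun x => (∑ i, pd i (pd i (regFund e)) x) * V x :=
    (hcl.mul hV.continuous).integrable_of_hasCompactSupport hVc.mul_left
  have i3 : Integrable fun x => regFund e x * lapE V x :=
    (hφ.continuous.mul hlapc).integrable_of_hasCompactSupport hlaps.mul_left
  have hbub : Continuous fun x : E4 => bubble (c • x) := by
    unfold bubble
    refine continuous_const.mul (Continuous.inv₀ (by fun_prop) fun x => by positivity)
  have i2 : Integrable fun x => (c ^ 4 * bubble (c • x)) * (cutoff (‖x‖ ^ 2) * V x) :=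
    ((continuous_const.mul hbub).mul hg).integrable_of_hasCompactSupport hVc.mul_left.mul_left
  have hid : ∀ x, 4 * π ^ 2 * ((c ^ 4 * bubble (c • x)) * (cutoff (‖x‖ ^ 2) * V x))
      = regFundError e (‖x‖ ^ 2) * V x - (∑ i, pd i (pd i (regFund e)) x) * V x := by
    intro x
    rw [sum_pd_pd_regFund he0, bubble, norm_smul, Real.norm_eq_abs, mul_pow, sq_abs]
    have : (‖x‖ ^ 2 + e) = (1 + c ^ 2 * ‖x‖ ^ 2) / c ^ 2 := by
      rw [he]; field_simp; ring
    rw [this, he]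
    field_simp
    ring
  have ierr : Integrable fun x => regFundError e (‖x‖ ^ 2) * V x := by
    refine ((i2.const_mul (4 * π ^ 2)).add i1).congr (.of_forall fun x => ?_)
    simp only [Pi.add_apply]
    rw [hid]; ring
  have hfin : 4 * π ^ 2 * ∫ x, (c ^ 4 * bubble (c • x)) * (cutoff (‖x‖ ^ 2) * V x)
      = ∫ x, (regFundError e (‖x‖ ^ 2) * V x - regFund e x * lapE V x) := by
    rw [← integral_const_mul]
    simp_rw [hid]
    rw [integral_sub ierr i1, integral_sub ierr i3, integral_mul_lapE hφ hV hVc]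
  rw [hfin, ← Real.enorm_eq_ofReal_abs]
  refine (enorm_integral_le_lintegral_enorm _).trans ?_
  rw [← lintegral_indicator (by measurability)]
  have hnz : ∀ᵐ x : E4, ‖x‖ ≠ 0 ∧ ‖x‖ ≠ 1 := by
    have a1 : ∀ᵐ x : E4, x ≠ 0 := Measure.ae_ne volume 0
    have a2 : ∀ᵐ x : E4, x ∉ Metric.sphere (0 : E4) 1 :=
      measure_eq_zero_iff_ae_notMem.1 (Measure.addHaar_sphere volume 0 1)
    filter_upwards [a1, a2] with x h1 h2
    exact ⟨norm_ne_zero_iff.2 h1, by simpa using h2⟩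
  refine lintegral_mono_ae ?_
  filter_upwards [hnz] with x hx
  by_cases hx1 : ‖x‖ < 1
  · rw [Set.indicator_of_mem (show x ∈ {x : E4 | ‖x‖ < 1} from hx1), Real.enorm_eq_ofReal_abs]
    refine ENNReal.ofReal_le_ofReal ?_
    have hx0 : 0 < ‖x‖ := lt_of_le_of_ne (norm_nonneg x) (Ne.symm hx.1)
    have hs : 0 < ‖x‖ ^ 2 := by positivity
    have hs1 : ‖x‖ ^ 2 ≤ 1 := pow_le_one₀ hx0.le hx1.le
    obtain ⟨k1, k2⟩ := hb _ ⟨hs.le, hs1⟩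
    have b1 := abs_regFundError_le he0 hs hs1 k1 k2
    have b2 : |regFund e x| ≤ (‖x‖ ^ 2)⁻¹ := by
      unfold regFund
      rw [abs_of_nonneg (mul_nonneg (cutoff_nonneg _) (by positivity))]
      refine (mul_le_of_le_one_left (by positivity) (cutoff_le_one _)).trans ?_
      exact inv_anti₀ hs (by linarith)
    refine (abs_sub _ _).trans ?_
    rw [abs_mul, abs_mul]
    have c1 := mul_le_mul_of_nonneg_right b1 (abs_nonneg (V x))
    have c2 := mul_le_mul_of_nonneg_right b2 (abs_nonneg (lapE V x))
    linarith
  · rw [Set.indicator_of_notMem (show x ∉ {x : E4 | ‖x‖ < 1} from hx1)]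
    have hx2 : 1 < ‖x‖ := lt_of_le_of_ne (not_lt.1 hx1) (Ne.symm hx.2)
    have hs : 1 < ‖x‖ ^ 2 := one_lt_pow₀ hx2 two_ne_zero
    simp [regFundError, regFund, cutoff_eq_zero hs.le, deriv_cutoff_eq_zero hs,
      deriv_deriv_cutoff_eq_zero hs]

lemma lintegral_mul_sq_le {X : Type*} [MeasurableSpace X] {μ : Measure X} {f g : X → ENNReal}
    (hf : AEMeasurable f μ) (hg : AEMeasurable g μ) :
    (∫⁻ x, f x * g x ∂μ) ^ 2 ≤ (∫⁻ x, f x ^ 2 ∂μ) * ∫⁻ x, g x ^ 2 ∂μ := by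
  have h := ENNReal.lintegral_mul_le_Lp_mul_Lq μ (p := 2) (q := 2)
    (Real.holderConjugate_iff.2 (by norm_num)) hf hg
  have h2 := ENNReal.pow_le_pow_left (n := 2) h
  rw [mul_pow, ← ENNReal.rpow_natCast (_ ^ (1 / (2 : ℝ))),
    ← ENNReal.rpow_natCast (_ ^ (1 / (2 : ℝ))),
    ← ENNReal.rpow_mul, ← ENNReal.rpow_mul] at h2
  norm_num at h2
  exact h2

lemma lintegral_comp_add_smul {G : E4 → ENNReal} (hG : Measurable G) (x : E4) {l : ℝ} (hl : 0 < l) :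
    ∫⁻ y, G (x + l • y) = ENNReal.ofReal (l ^ 4)⁻¹ * ∫⁻ z, G z := by
  have h := Measure.map_addHaar_smul (volume : Measure E4) hl.ne'
  rw [finrank_euclideanSpace_fin, abs_of_pos (by positivity)] at h
  have h2 : ∫⁻ z, G (x + z) ∂(Measure.map (l • ·) (volume : Measure E4)) = ∫⁻ y, G (x + l • y) :=
    lintegral_map (hG.comp (measurable_const_add x)) (measurable_const_smul l)
  rw [← h2, h, lintegral_smul_measure, lintegral_add_left_eq_self G x, smul_eq_mul]

lemma pd_comp_add_smul {f : E4 → ℝ} (hf : Differentiable ℝ f) (x : E4) (l : ℝ) (i : Fin 4) :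
    pd i (fun y => f (x + l • y)) = fun y => l * pd i f (x + l • y) := by
  ext y
  have h1 : HasFDerivAt (fun y : E4 => x + l • y) (l • ContinuousLinearMap.id ℝ E4) y :=
    ((hasFDerivAt_id y).const_smul l).const_add x
  have h2 := ((hf (x + l • y)).hasFDerivAt.comp y h1).fderiv
  unfold pd
  simp only [Function.comp_def] at h2
  rw [h2]
  simp

lemma contDiff_pd {f : E4 → ℝ} (hf : ContDiff ℝ (⊤ : ℕ∞) f) (i : Fin 4) :
    ContDiff ℝ (⊤ : ℕ∞) (pd i f) :=
  (hf.fderiv_right (m := (⊤ : ℕ∞)) (by simp)).clm_apply contDiff_const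

lemma lapE_eq_sum (f : E4 → ℝ) (x : E4) : lapE f x = ∑ i, pd i (pd i f) x := rfl

lemma continuous_lapE {f : E4 → ℝ} (hf : ContDiff ℝ (⊤ : ℕ∞) f) : Continuous (lapE f) :=
  continuous_finsetSum _ fun i _ => (contDiff_pd (contDiff_pd hf i) i).continuous

lemma lapE_comp_add_smul {f : E4 → ℝ} (hf : ContDiff ℝ (⊤ : ℕ∞) f) (x : E4) (l : ℝ) (y : E4) :
    lapE (fun y => f (x + l • y)) y = l ^ 2 * lapE f (x + l • y) := by
  simp only [lapE_eq_sum]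
  rw [Finset.mul_sum]
  refine Finset.sum_congr rfl fun i _ => ?_
  have hd := (contDiff_pd hf i).differentiable (by simp)
  rw [pd_comp_add_smul (hf.differentiable (by simp)), pd_const_mul, pd_comp_add_smul hd]
  · ring
  · exact (hd _).comp y (by fun_prop)

lemma exists_local_representation_at :
    ∃ K : ℝ, 0 ≤ K ∧ ∀ V : E4 → ℝ, ContDiff ℝ (⊤ : ℕ∞) V → HasCompactSupport V →
      ∀ (x : E4) (l : ℝ), 0 < l →
      ENNReal.ofReal (4 * π ^ 2 * |V x|) ≤
        ∫⁻ z in {z : E4 | ‖z - x‖ < l},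
          ENNReal.ofReal ((‖z - x‖ ^ 2)⁻¹ * (|lapE V z| + K * (l ^ 2)⁻¹ * |V z|)) := by
  obtain ⟨K, hK, h⟩ := exists_local_representation
  refine ⟨K, hK, fun V hV hVc x l hl => ?_⟩
  have hW : ContDiff ℝ (⊤ : ℕ∞) fun y => V (x + l • y) :=
    hV.comp (contDiff_const.add (contDiff_const_smul l))
  have hWc : HasCompactSupport fun y => V (x + l • y) :=
    hVc.comp_homeomorph ((Homeomorph.smulOfNeZero l hl.ne').trans (Homeomorph.addLeft x))
  have h1 := h _ hW hWc
  simp only [smul_zero, add_zero, lapE_comp_add_smul hV] at h1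
  refine h1.trans (le_of_eq ?_)
  set G : E4 → ENNReal := Set.indicator {z : E4 | ‖z - x‖ < l} fun z =>
    ENNReal.ofReal ((‖z - x‖ ^ 2)⁻¹ * (|lapE V z| + K * (l ^ 2)⁻¹ * |V z|)) with hG
  have hms : MeasurableSet {z : E4 | ‖z - x‖ < l} :=
    measurableSet_lt (by fun_prop) measurable_const
  have hGm : Measurable G := by
    refine Measurable.indicator ?_ hms
    have := (continuous_lapE hV).measurable
    have := hV.continuous.measurable
    fun_prop
  rw [← lintegral_indicator hms]
  change _ = ∫⁻ z, G z
  have h2 : ∫⁻ z, G z = ENNReal.ofReal (l ^ 4) * ∫⁻ y, G (x + l • y) := by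
    rw [lintegral_comp_add_smul hGm x hl, ← mul_assoc, ← ENNReal.ofReal_mul (by positivity),
      mul_inv_cancel₀ (by positivity), ENNReal.ofReal_one, one_mul]
  rw [h2, ← lintegral_const_mul' _ _ ENNReal.ofReal_ne_top,
    ← lintegral_indicator (measurableSet_lt (by fun_prop) measurable_const)]
  congr 1
  ext y
  have hny : ‖x + l • y - x‖ = l * ‖y‖ := by
    rw [add_sub_cancel_left, norm_smul, Real.norm_eq_abs, abs_of_pos hl]
  have hiff : (x + l • y ∈ {z : E4 | ‖z - x‖ < l}) ↔ y ∈ {y : E4 | ‖y‖ < 1} := by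
    simp only [Set.mem_ofPred_eq, hny]
    exact mul_lt_iff_lt_one_right hl
  simp only [hG]
  by_cases hy : y ∈ {y : E4 | ‖y‖ < 1}
  · rw [Set.indicator_of_mem hy, Set.indicator_of_mem (hiff.2 hy), hny,
      ← ENNReal.ofReal_mul (by positivity), abs_mul, abs_of_pos (by positivity : 0 < l ^ 2)]
    congr 1
    by_cases h0 : ‖y‖ = 0
    · simp [h0]
    · field_simp
  · rw [Set.indicator_of_notMem hy, Set.indicator_of_notMem (fun h => hy (hiff.1 h)), mul_zero]

lemma IsBallTest.gapOp_eq {u : E4 → ℝ} (hu : IsBallTest u) (x : E4) :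
    _root_.gapOp u x = -(ballDefect x ^ 3 / 4) * lapE (_root_.rescaled u) x - u x / 4 := by
  set w := _root_.rescaled u with hw
  have hwt : IsBallTest w := hu.rescaled
  have hu' : u = fun y => ballDefect y * w y := by
    ext y
    by_cases hy : y ∈ Metric.ball (0 : E4) 1
    · have := (ballDefect_pos hy).ne'
      simp only [hw, _root_.rescaled]
      field_simp
    · rw [hu.eq_zero hy, hwt.eq_zero hy, mul_zero]
  have hdw := hwt.differentiable
  have p1 : ∀ i, _root_.pd i u = fun y => -2 * (y i * w y) + ballDefect y * _root_.pd i w y := by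
    intro i
    ext y
    rw [hu', pd_mul i (differentiable_ballDefect y) (hdw y), pd_ballDefect]
    ring
  have p2 : ∀ i, _root_.pd i (_root_.pd i u) x = -2 * w x - 4 * x i * _root_.pd i w x
      + ballDefect x * _root_.pd i (_root_.pd i w) x := by
    intro i
    have hdi := (hwt.pd i).differentiable
    have hci := differentiableAt_coord i x
    rw [p1, pd_add (f := fun y => -2 * (y i * w y))
      (g := fun y => ballDefect y * _root_.pd i w y) i ((hci.mul (hdw x)).const_mul _)
      ((differentiable_ballDefect x).mul (hdi x)), pd_const_mul (f := fun y => y i * w y) _ _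
      (hci.mul (hdw x)), pd_mul i hci (hdw x), pd_mul i (differentiable_ballDefect x) (hdi x),
      pd_ballDefect, pd_coord]
    simp
    ring
  have hs := sum_sq_coord x
  have hux : u x = ballDefect x * w x := congrFun hu' x
  rw [_root_.gapOp, hypLap_eq, lapE_eq_sum]
  simp only [p2, hux]
  simp only [p1]
  simp only [Fin.sum_univ_four] at hs ⊢
  have hs' : x 3 ^ 2 = 1 - ballDefect x - x 0 ^ 2 - x 1 ^ 2 - x 2 ^ 2 := by linarith
  ring_nf
  rw [hs']
  ring

lemma ballDefect_sub_le {x z : E4} (hx : x ∈ Metric.ball (0 : E4) 1)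
    (hz : z ∈ Metric.ball (0 : E4) 1) : |ballDefect z - ballDefect x| ≤ 2 * ‖z - x‖ := by
  have h1 : ‖x‖ < 1 := by simpa using hx
  have h2 : ‖z‖ < 1 := by simpa using hz
  have h3 := abs_norm_sub_norm_le z x
  have e : ballDefect z - ballDefect x = -((‖z‖ + ‖x‖) * (‖z‖ - ‖x‖)) := by
    unfold ballDefect; ring
  rw [e, abs_neg, abs_mul, abs_of_nonneg (by positivity)]
  exact mul_le_mul (by linarith) h3 (abs_nonneg _) (by norm_num)

lemma mem_ball_of_near {x z : E4} (hx : x ∈ Metric.ball (0 : E4) 1)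
    (hz : ‖z - x‖ < ballDefect x / 2) : z ∈ Metric.ball (0 : E4) 1 := by
  have h1 : ‖x‖ < 1 := by simpa using hx
  have h2 : ‖z‖ ≤ ‖x‖ + ‖z - x‖ := by simpa using norm_add_le x (z - x)
  have h3 : ballDefect x / 2 ≤ 1 - ‖x‖ := by
    unfold ballDefect
    nlinarith [sq_nonneg (1 - ‖x‖)]
  simpa using (by linarith : ‖z‖ < 1)

/-- The local kernel in the representation of a function by the shifted Laplacian. -/
noncomputable def kern (x z : E4) : ENNReal :=
  Set.indicator {z : E4 | ‖z - x‖ < ballDefect x / 8}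
    (fun z => ENNReal.ofReal ((4 * π ^ 2)⁻¹ * (ballDefect x / ballDefect z) * (‖z - x‖ ^ 2)⁻¹)) z

/-- The density whose `L²` norm is the hyperbolic `L²` norm of `gapOp u`. -/
noncomputable def source (u : E4 → ℝ) (z : E4) : ENNReal :=
  ENNReal.ofReal (|gapOp u z| * 4 / ballDefect z ^ 2)

lemma lintegral_ball_norm_sq_inv_mul_pow_four_le {w : E4 → ℝ} (hw : Continuous w) (x : E4) {l : ℝ}
    (hl : 0 ≤ l) :
    (∫⁻ z in {z : E4 | ‖z - x‖ < l}, ENNReal.ofReal ((‖z - x‖ ^ 2)⁻¹ * |w z|)) ^ 4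
      ≤ ENNReal.ofReal (4 * π ^ 6 * l ^ 4) * ∫⁻ z, ENNReal.ofReal (w z ^ 4) := by
  have hwm := hw.measurable
  set μ := (volume : Measure E4).restrict {z : E4 | ‖z - x‖ < l} with hμ
  have a1 := lintegral_mul_sq_le (μ := μ)
    (f := fun z => ENNReal.ofReal ((‖z - x‖ * √‖z - x‖)⁻¹))
    (g := fun z => ENNReal.ofReal ((√‖z - x‖)⁻¹ * |w z|)) (by fun_prop) (by fun_prop)
  have a2 := lintegral_mul_sq_le (μ := μ)
    (f := fun z => ENNReal.ofReal (‖z - x‖⁻¹))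
    (g := fun z => ENNReal.ofReal (w z ^ 2)) (by fun_prop) (by fun_prop)
  have b1 : ∀ z, ENNReal.ofReal ((‖z - x‖ * √‖z - x‖)⁻¹) * ENNReal.ofReal ((√‖z - x‖)⁻¹ * |w z|)
      = ENNReal.ofReal ((‖z - x‖ ^ 2)⁻¹ * |w z|) := by
    intro z
    rw [← ENNReal.ofReal_mul (by positivity)]
    congr 1
    have := Real.mul_self_sqrt (norm_nonneg (z - x))
    rw [← mul_assoc, ← mul_inv, mul_assoc, this, pow_two]
  have b2 : ∀ z,
      ENNReal.ofReal ((‖z - x‖ * √‖z - x‖)⁻¹) ^ 2 = ENNReal.ofReal ((‖z - x‖ ^ 3)⁻¹) := by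
    intro z
    rw [← ENNReal.ofReal_pow (by positivity), inv_pow, mul_pow, Real.sq_sqrt (norm_nonneg _)]
    congr 2
  have b3 : ∀ z, ENNReal.ofReal ((√‖z - x‖)⁻¹ * |w z|) ^ 2
      = ENNReal.ofReal (‖z - x‖⁻¹) * ENNReal.ofReal (w z ^ 2) := by
    intro z
    rw [← ENNReal.ofReal_pow (by positivity), ← ENNReal.ofReal_mul (by positivity), mul_pow,
      inv_pow, Real.sq_sqrt (norm_nonneg _), sq_abs]
  have b4 : ∀ z, ENNReal.ofReal (‖z - x‖⁻¹) ^ 2 = ENNReal.ofReal ((‖z - x‖ ^ 2)⁻¹) := by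
    intro z
    rw [← ENNReal.ofReal_pow (by positivity), inv_pow]
  have b5 : ∀ z, ENNReal.ofReal (w z ^ 2) ^ 2 = ENNReal.ofReal (w z ^ 4) := by
    intro z
    rw [← ENNReal.ofReal_pow (by positivity)]
    congr 1; ring
  simp only [b1, b2, b3] at a1
  simp only [b4, b5] at a2
  rw [hμ] at a1 a2
  rw [lintegral_ball_norm_cube_inv x hl] at a1
  rw [lintegral_ball_norm_sq_inv x hl] at a2
  have a3 := ENNReal.pow_le_pow_left (n := 2) a1
  rw [← pow_mul, mul_pow] at a3
  refine a3.trans ((mul_le_mul_right a2 _).trans ?_)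
  rw [← mul_assoc, ← ENNReal.ofReal_pow (by positivity), ← ENNReal.ofReal_mul (by positivity)]
  refine mul_le_mul' (le_of_eq ?_) (lintegral_mono' Measure.restrict_le_self le_rfl)
  congr 1; ring

/-- A function is controlled by the local potential of its image under the shifted Laplacian. -/
lemma exists_representation :
    ∃ C : ℝ, 0 ≤ C ∧ ∀ u : E4 → ℝ, IsBallTest u → ∀ x ∈ Metric.ball (0 : E4) 1,
      ENNReal.ofReal |u x| ≤ (∫⁻ z, kern x z * source u z)
        + ENNReal.ofReal (C * √(gapForm u)) := by
  obtain ⟨K, hK, hrep⟩ := exists_local_representation_at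
  obtain ⟨S, hS, hsob⟩ := exists_sobolev_const
  set c : ℝ := 4 * π ^ 6 * S + 1 with hc
  have hc1 : 1 ≤ c := by
    have : 0 ≤ 4 * π ^ 6 * S := by positivity
    linarith
  refine ⟨(2 + 64 * K) * (c / 8), by positivity, fun u hu x hx => ?_⟩
  have hD := hu.gapForm_nonneg
  have hd := ballDefect_pos hx
  set w := rescaled u with hw
  have hwt : IsBallTest w := hu.rescaled
  set l := ballDefect x / 8 with hl
  have hl0 : 0 < l := by positivity
  have h1 := hrep w hwt.smooth hwt.compact x l hl0
  set B : Set E4 := {z : E4 | ‖z - x‖ < l} with hB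
  have hms : MeasurableSet B := measurableSet_lt (by fun_prop) measurable_const
  have hux : |u x| = (ballDefect x * (4 * π ^ 2)⁻¹) * (4 * π ^ 2 * |w x|) := by
    have : u x = ballDefect x * w x := by
      simp only [hw, rescaled]; field_simp
    rw [this, abs_mul, abs_of_pos hd]
    field_simp
  have hI := lintegral_ball_norm_sq_inv_mul_pow_four_le hwt.smooth.continuous x hl0.le
  rw [← hB] at hI
  have iw4 : Integrable fun x => w x ^ 4 := by
    refine ((hwt.mul hwt).mul (hwt.mul hwt)).integrable.congr (.of_forall fun x => ?_)
    simp only []; ring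
  have hX : ∫⁻ z, ENNReal.ofReal (w z ^ 4) ≤ ENNReal.ofReal (S * gapForm u ^ 2) := by
    rw [← ofReal_integral_eq_lintegral_ofReal iw4
      (.of_forall fun x => (show Even 4 by decide).pow_nonneg _)]
    exact ENNReal.ofReal_le_ofReal (hsob u hu)
  have hI2 : ∫⁻ z in B, ENNReal.ofReal ((‖z - x‖ ^ 2)⁻¹ * |w z|)
      ≤ ENNReal.ofReal (c * l * √(gapForm u)) := by
    rw [← ENNReal.pow_le_pow_left_iff (n := 4) (by norm_num)]
    refine hI.trans ((mul_le_mul_right hX _).trans ?_)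
    rw [← ENNReal.ofReal_mul (by positivity), ← ENNReal.ofReal_pow (by positivity)]
    refine ENNReal.ofReal_le_ofReal ?_
    have e1 : √(gapForm u) ^ 4 = gapForm u ^ 2 := by
      rw [show 4 = 2 * 2 from rfl, pow_mul, Real.sq_sqrt hD]
    rw [mul_pow, mul_pow, e1]
    have e2 : 4 * π ^ 6 * S ≤ c ^ 4 := by
      have : c ≤ c ^ 4 := le_self_pow₀ hc1 (by norm_num)
      linarith
    calc 4 * π ^ 6 * l ^ 4 * (S * gapForm u ^ 2)
        = 4 * π ^ 6 * S * (l ^ 4 * gapForm u ^ 2) := by ring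
      _ ≤ c ^ 4 * (l ^ 4 * gapForm u ^ 2) := mul_le_mul_of_nonneg_right e2 (by positivity)
      _ = _ := by ring
  have hpt : ∀ z ∈ B, ENNReal.ofReal (ballDefect x * (4 * π ^ 2)⁻¹)
        * ENNReal.ofReal ((‖z - x‖ ^ 2)⁻¹ * (|lapE w z| + K * (l ^ 2)⁻¹ * |w z|))
      ≤ kern x z * source u z + ENNReal.ofReal ((2 + 64 * K) * (ballDefect x)⁻¹)
        * ENNReal.ofReal ((‖z - x‖ ^ 2)⁻¹ * |w z|) := by
    intro z hz
    have hzl : ‖z - x‖ < ballDefect x / 8 := hz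
    have hzb : z ∈ Metric.ball (0 : E4) 1 := mem_ball_of_near hx (by linarith)
    have hdz := ballDefect_pos hzb
    have hcmp := abs_le.1 (ballDefect_sub_le hx hzb)
    have hlow : 3 / 4 * ballDefect x ≤ ballDefect z := by linarith [hcmp.1]
    rw [kern, Set.indicator_of_mem (show z ∈ {z : E4 | ‖z - x‖ < ballDefect x / 8} from hz), source,
      ← ENNReal.ofReal_mul (by positivity), ← ENNReal.ofReal_mul (by positivity),
      ← ENNReal.ofReal_mul (by positivity), ← ENNReal.ofReal_add (by positivity) (by positivity)]
    refine ENNReal.ofReal_le_ofReal ?_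
    have huz : u z = ballDefect z * w z := by
      simp only [hw, rescaled]; field_simp
    have hlap : lapE w z = -(4 / ballDefect z ^ 3 * gapOp u z) - w z / ballDefect z ^ 2 := by
      rw [hu.gapOp_eq z, ← hw, huz]
      field_simp
      ring
    have hlap2 : |lapE w z| ≤ 4 / ballDefect z ^ 3 * |gapOp u z| + |w z| / ballDefect z ^ 2 := by
      rw [hlap]
      refine (abs_sub _ _).trans (le_of_eq ?_)
      rw [abs_neg, abs_mul, abs_of_pos (by positivity : 0 < 4 / ballDefect z ^ 3), abs_div,
        abs_of_pos (by positivity : 0 < ballDefect z ^ 2)]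
    have hinv : (ballDefect z ^ 2)⁻¹ ≤ 2 * (ballDefect x ^ 2)⁻¹ := by
      have : (3 / 4 * ballDefect x) ^ 2 ≤ ballDefect z ^ 2 :=
        pow_le_pow_left₀ (by positivity) hlow 2
      have h5 : (ballDefect z ^ 2)⁻¹ ≤ ((3 / 4 * ballDefect x) ^ 2)⁻¹ :=
        inv_anti₀ (by positivity) this
      refine h5.trans ?_
      rw [mul_pow, mul_inv]
      exact mul_le_mul_of_nonneg_right (by norm_num) (by positivity)
    have hpi : (4 * π ^ 2)⁻¹ ≤ 1 := inv_le_one_of_one_le₀ (by nlinarith [Real.pi_gt_three])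
    have hr0 : 0 ≤ (‖z - x‖ ^ 2)⁻¹ := by positivity
    have hl2 : (l ^ 2)⁻¹ = 64 * (ballDefect x ^ 2)⁻¹ := by
      rw [hl]; field_simp; norm_num
    have s1 : |lapE w z| + K * (l ^ 2)⁻¹ * |w z| ≤ 4 / ballDefect z ^ 3 * |gapOp u z|
        + (2 + 64 * K) * (ballDefect x ^ 2)⁻¹ * |w z| := by
      have := mul_le_mul_of_nonneg_right hinv (abs_nonneg (w z))
      rw [hl2]
      rw [div_eq_inv_mul] at hlap2
      rw [div_eq_inv_mul] at hlap2
      rw [div_eq_inv_mul]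
      linarith
    calc ballDefect x * (4 * π ^ 2)⁻¹ * ((‖z - x‖ ^ 2)⁻¹ * (|lapE w z| + K * (l ^ 2)⁻¹ * |w z|))
        ≤ ballDefect x * (4 * π ^ 2)⁻¹ * ((‖z - x‖ ^ 2)⁻¹ * (4 / ballDefect z ^ 3 * |gapOp u z|
        + (2 + 64 * K) * (ballDefect x ^ 2)⁻¹ * |w z|)) := by gcongr
      _ = (4 * π ^ 2)⁻¹ * (ballDefect x / ballDefect z) * (‖z - x‖ ^ 2)⁻¹
            * (|gapOp u z| * 4 / ballDefect z ^ 2)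
          + (4 * π ^ 2)⁻¹ * ((2 + 64 * K) * (ballDefect x)⁻¹ * ((‖z - x‖ ^ 2)⁻¹ * |w z|)) := by
        rw [mul_add, mul_add]
        congr 1
        · field_simp
        · field_simp
      _ ≤ _ := by
        refine add_le_add le_rfl (mul_le_of_le_one_left (by positivity) hpi)
  have hwm := hwt.smooth.continuous.measurable
  calc ENNReal.ofReal |u x|
      = ENNReal.ofReal (ballDefect x * (4 * π ^ 2)⁻¹) * ENNReal.ofReal (4 * π ^ 2 * |w x|) := by
        rw [← ENNReal.ofReal_mul (by positivity), hux]
    _ ≤ ENNReal.ofReal (ballDefect x * (4 * π ^ 2)⁻¹) * _ := mul_le_mul_right h1 _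
    _ = ∫⁻ z in B, ENNReal.ofReal (ballDefect x * (4 * π ^ 2)⁻¹)
        * ENNReal.ofReal ((‖z - x‖ ^ 2)⁻¹ * (|lapE w z| + K * (l ^ 2)⁻¹ * |w z|)) :=
      (lintegral_const_mul' _ _ ENNReal.ofReal_ne_top).symm
    _ ≤ ∫⁻ z in B, (kern x z * source u z + ENNReal.ofReal ((2 + 64 * K) * (ballDefect x)⁻¹)
        * ENNReal.ofReal ((‖z - x‖ ^ 2)⁻¹ * |w z|)) := setLIntegral_mono' hms hpt
    _ = (∫⁻ z in B, kern x z * source u z)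
        + ENNReal.ofReal ((2 + 64 * K) * (ballDefect x)⁻¹)
          * ∫⁻ z in B, ENNReal.ofReal ((‖z - x‖ ^ 2)⁻¹ * |w z|) := by
      rw [lintegral_add_right _ (by fun_prop), lintegral_const_mul' _ _ ENNReal.ofReal_ne_top]
    _ ≤ (∫⁻ z, kern x z * source u z) + ENNReal.ofReal ((2 + 64 * K) * (ballDefect x)⁻¹)
          * ENNReal.ofReal (c * l * √(gapForm u)) := by
      gcongr
      exact Measure.restrict_le_self
    _ = _ := by
      rw [← ENNReal.ofReal_mul (by positivity)]
      congr 2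
      rw [hl]
      field_simp

lemma measurable_ballDefect : Measurable ballDefect := continuous_ballDefect.measurable

lemma measurable_kern : Measurable fun p : E4 × E4 => kern p.1 p.2 := by
  have h := measurable_ballDefect
  have e : (fun p : E4 × E4 => kern p.1 p.2)
      = Set.indicator {p : E4 × E4 | ‖p.2 - p.1‖ < ballDefect p.1 / 8} fun p =>
        ENNReal.ofReal
          ((4 * π ^ 2)⁻¹ * (ballDefect p.1 / ballDefect p.2) * (‖p.2 - p.1‖ ^ 2)⁻¹) := by
    ext p
    simp only [kern, Set.indicator, Set.mem_ofPred_eq]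
  rw [e]
  refine Measurable.indicator (by fun_prop) (measurableSet_lt (by fun_prop) (by fun_prop))

lemma inv_sq_mul_inv_sq_le_of_far {p q δ : ℝ} (hδ : 0 < δ) (hp : 2 * δ ≤ p) (hq : p - δ ≤ q) :
    (p ^ 2)⁻¹ * (q ^ 2)⁻¹ ≤ (p ^ 4)⁻¹ + 6 * δ * |p ^ 5|⁻¹ := by
  have hp0 : 0 < p := by linarith
  have hpd : 0 < p - δ := by linarith
  rw [abs_of_pos (by positivity)]
  have h1 : (q ^ 2)⁻¹ ≤ ((p - δ) ^ 2)⁻¹ :=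
    inv_anti₀ (by positivity) (pow_le_pow_left₀ hpd.le hq 2)
  have h2 : ((p - δ) ^ 2)⁻¹ ≤ (p + 6 * δ) * (p ^ 3)⁻¹ := by
    rw [inv_eq_one_div, ← div_eq_mul_inv, div_le_div_iff₀ (by positivity) (by positivity)]
    have : 0 ≤ δ * ((p - 2 * δ) * (4 * p - 3 * δ)) :=
      mul_nonneg hδ.le (mul_nonneg (by linarith) (by linarith))
    nlinarith
  calc (p ^ 2)⁻¹ * (q ^ 2)⁻¹ ≤ (p ^ 2)⁻¹ * ((p + 6 * δ) * (p ^ 3)⁻¹) :=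
        mul_le_mul_of_nonneg_left (h1.trans h2) (by positivity)
    _ = _ := by field_simp

lemma inv_sq_mul_inv_sq_le_of_near {p q δ : ℝ} (hδ : 0 < δ) (hp : 0 < p) (hq : 0 < q)
    (h : δ ≤ p + q) :
    (p ^ 2)⁻¹ * (q ^ 2)⁻¹ ≤ 4 / δ ^ 2 * (p ^ 2)⁻¹ + 4 / δ ^ 2 * (q ^ 2)⁻¹ := by
  have key : ∀ {r : ℝ}, δ / 2 ≤ r → (r ^ 2)⁻¹ ≤ 4 / δ ^ 2 := by
    intro r hr
    have := inv_anti₀ (by positivity) (pow_le_pow_left₀ (by positivity) hr 2)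
    refine this.trans (le_of_eq ?_)
    field_simp
    norm_num
  have hp' : 0 ≤ 4 / δ ^ 2 * (p ^ 2)⁻¹ := by positivity
  have hq' : 0 ≤ 4 / δ ^ 2 * (q ^ 2)⁻¹ := by positivity
  rcases le_total (δ / 2) p with h1 | h1
  · have := mul_le_mul_of_nonneg_right (key h1) (by positivity : 0 ≤ (q ^ 2)⁻¹)
    linarith
  · have h2 : δ / 2 ≤ q := by linarith
    have := mul_le_mul_of_nonneg_left (key h2) (by positivity : 0 ≤ (p ^ 2)⁻¹)
    linarith

lemma mul_sq_le_add_cube {a b : ℝ} (ha : 0 ≤ a) (hb : 0 ≤ b) : a * b ^ 2 ≤ a ^ 3 + b ^ 3 := by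
  rcases le_total a b with h | h
  · have : a * b ^ 2 ≤ b * b ^ 2 := mul_le_mul_of_nonneg_right h (sq_nonneg _)
    have : 0 ≤ a ^ 3 := by positivity
    nlinarith
  · have : a * b ^ 2 ≤ a * a ^ 2 :=
      mul_le_mul_of_nonneg_left (pow_le_pow_left₀ hb h 2) ha
    have : 0 ≤ b ^ 3 := by positivity
    nlinarith

lemma weight_mul_le {dx dy dz p q : ℝ} (hdx : 0 < dx) (hdy : 0 < dy) (hp : 0 < p) (hq : 0 < q)
    (hpx : p < dx / 8) (h1 : |dz - dx| ≤ 2 * p) (h2 : |dz - dy| ≤ 2 * q) :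
    (dx / dz) * (p ^ 2)⁻¹ * ((dy / dz) * (q ^ 2)⁻¹)
      ≤ (p ^ 2)⁻¹ * (q ^ 2)⁻¹ + 8 / dx * (p ^ 3)⁻¹ + 8 / dx * (q ^ 3)⁻¹ := by
  rw [abs_le] at h1 h2
  have hz : 3 / 4 * dx ≤ dz := by linarith
  have hz0 : 0 < dz := by linarith
  have hx1 : dx / dz ≤ 1 + 8 / 3 * (p / dx) := by
    rw [div_le_iff₀ hz0]
    have : p ≤ 4 / 3 * (p / dx) * dz := by
      calc p = 4 / 3 * (p / dx) * (3 / 4 * dx) := by field_simp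
        _ ≤ _ := mul_le_mul_of_nonneg_left hz (by positivity)
    linarith
  have hy1 : dy / dz ≤ 1 + 8 / 3 * (q / dx) := by
    rw [div_le_iff₀ hz0]
    have : q ≤ 4 / 3 * (q / dx) * dz := by
      calc q = 4 / 3 * (q / dx) * (3 / 4 * dx) := by field_simp
        _ ≤ _ := mul_le_mul_of_nonneg_left hz (by positivity)
    linarith
  have hpd : p / dx ≤ 1 / 8 := by
    rw [div_le_iff₀ hdx]; linarith
  have hqd0 : 0 ≤ q / dx := by positivity
  have hpd0 : 0 ≤ p / dx := by positivity
  have hprod : (dx / dz) * (dy / dz) ≤ 1 + 4 * (p / dx) + 4 * (q / dx) := by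
    refine (mul_le_mul hx1 hy1 (by positivity) (by positivity)).trans ?_
    nlinarith
  have k1 := mul_sq_le_add_cube (a := p⁻¹) (b := q⁻¹) (by positivity) (by positivity)
  have k2 := mul_sq_le_add_cube (a := q⁻¹) (b := p⁻¹) (by positivity) (by positivity)
  calc (dx / dz) * (p ^ 2)⁻¹ * ((dy / dz) * (q ^ 2)⁻¹)
      = (dx / dz) * (dy / dz) * ((p ^ 2)⁻¹ * (q ^ 2)⁻¹) := by ring
    _ ≤ (1 + 4 * (p / dx) + 4 * (q / dx)) * ((p ^ 2)⁻¹ * (q ^ 2)⁻¹) :=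
      mul_le_mul_of_nonneg_right hprod (by positivity)
    _ = (p ^ 2)⁻¹ * (q ^ 2)⁻¹ + 4 / dx * (p⁻¹ * q⁻¹ ^ 2) + 4 / dx * (q⁻¹ * p⁻¹ ^ 2) := by
      field_simp
    _ ≤ (p ^ 2)⁻¹ * (q ^ 2)⁻¹ + 4 / dx * (p⁻¹ ^ 3 + q⁻¹ ^ 3) + 4 / dx * (q⁻¹ ^ 3 + p⁻¹ ^ 3) := by
      gcongr
    _ = _ := by
      rw [inv_pow, inv_pow]; ring

/-- The Gram kernel of `kern`. -/
noncomputable def gramKern (x y : E4) : ENNReal := ∫⁻ z, kern x z * kern y z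

lemma kern_of_not_lt {x z : E4} (h : ¬ ‖z - x‖ < ballDefect x / 8) : kern x z = 0 :=
  Set.indicator_of_notMem (s := {z : E4 | ‖z - x‖ < ballDefect x / 8}) h _

lemma kern_mul_kern_eq_zero {x y z : E4} (hx : x ∈ Metric.ball (0 : E4) 1)
    (hy : y ∈ Metric.ball (0 : E4) 1) (h : ballDefect x / 3 ≤ ‖y - x‖) :
    kern x z * kern y z = 0 := by
  by_contra h0
  rw [mul_eq_zero, not_or] at h0
  have h1 : ‖z - x‖ < ballDefect x / 8 := by
    by_contra hc; exact h0.1 (kern_of_not_lt hc)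
  have h2 : ‖z - y‖ < ballDefect y / 8 := by
    by_contra hc; exact h0.2 (kern_of_not_lt hc)
  have hz := mem_ball_of_near hx (by linarith [ballDefect_pos hx] : ‖z - x‖ < ballDefect x / 2)
  have c1 := abs_le.1 (ballDefect_sub_le hx hz)
  have c2 := abs_le.1 (ballDefect_sub_le hy hz)
  have t : ‖y - x‖ ≤ ‖z - x‖ + ‖z - y‖ := by
    calc ‖y - x‖ = ‖(z - x) - (z - y)‖ := by congr 1; abel
      _ ≤ _ := norm_sub_le _ _
  linarith [c1.1, c1.2, c2.1, c2.2]

lemma gramKern_eq_zero {x y : E4} (hx : x ∈ Metric.ball (0 : E4) 1)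
    (hy : y ∈ Metric.ball (0 : E4) 1) (h : ballDefect x / 3 ≤ ‖y - x‖) : gramKern x y = 0 := by
  simp [gramKern, kern_mul_kern_eq_zero hx hy h]

lemma gramKern_le {x y : E4} (hx : x ∈ Metric.ball (0 : E4) 1)
    (hy : y ∈ Metric.ball (0 : E4) 1) (hxy : y ≠ x) (h : ‖y - x‖ < ballDefect x / 3) :
    ENNReal.ofReal (32 * π ^ 2) * gramKern x y
      ≤ ENNReal.ofReal (4 * log (ballDefect x / ‖y - x‖) + 180) := by
  set δ := ‖y - x‖ with hδ
  have hδ0 : 0 < δ := norm_pos_iff.2 (sub_ne_zero.2 hxy)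
  have hdx := ballDefect_pos hx
  have hdy := ballDefect_pos hy
  set D := ballDefect x with hD
  set S : Set E4 := {z : E4 | 2 * δ ≤ ‖z - x‖ ∧ ‖z - x‖ < D} with hS
  have hSm : MeasurableSet S := by
    rw [hS, Set.ofPred_and]
    exact (measurableSet_le (by fun_prop) (by fun_prop)).inter
      (measurableSet_lt (by fun_prop) (by fun_prop))
  have hbm : ∀ (c : E4) (r : ℝ), MeasurableSet {z : E4 | ‖z - c‖ < r} := fun c r =>
    measurableSet_lt (by fun_prop) measurable_const
  set T1 : E4 → ENNReal := S.indicator fun z => ENNReal.ofReal ((‖z - x‖ ^ 4)⁻¹)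
  set T2 : E4 → ENNReal := fun z =>
    ENNReal.ofReal (6 * δ) * S.indicator (fun z => ENNReal.ofReal (|‖z - x‖ ^ 5|⁻¹)) z
  set T3 : E4 → ENNReal := fun z => ENNReal.ofReal (4 / δ ^ 2) *
    {z : E4 | ‖z - x‖ < 2 * δ}.indicator (fun z => ENNReal.ofReal ((‖z - x‖ ^ 2)⁻¹)) z
  set T4 : E4 → ENNReal := fun z => ENNReal.ofReal (4 / δ ^ 2) *
    {z : E4 | ‖z - y‖ < 3 * δ}.indicator (fun z => ENNReal.ofReal ((‖z - y‖ ^ 2)⁻¹)) z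
  set T5 : E4 → ENNReal := fun z => ENNReal.ofReal (8 / D) *
    {z : E4 | ‖z - x‖ < D}.indicator (fun z => ENNReal.ofReal ((‖z - x‖ ^ 3)⁻¹)) z
  set T6 : E4 → ENNReal := fun z => ENNReal.ofReal (8 / D) *
    {z : E4 | ‖z - y‖ < D}.indicator (fun z => ENNReal.ofReal ((‖z - y‖ ^ 3)⁻¹)) z
  have m1 : Measurable T1 := Measurable.indicator (by fun_prop) hSm
  have m2 : Measurable T2 := (Measurable.indicator (by fun_prop) hSm).const_mul _
  have m3 : Measurable T3 := (Measurable.indicator (by fun_prop) (hbm _ _)).const_mul _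
  have m4 : Measurable T4 := (Measurable.indicator (by fun_prop) (hbm _ _)).const_mul _
  have m5 : Measurable T5 := (Measurable.indicator (by fun_prop) (hbm _ _)).const_mul _
  have hpt : ∀ z, kern x z * kern y z
      ≤ ENNReal.ofReal ((4 * π ^ 2)⁻¹ ^ 2) * (T1 z + (T2 z + (T3 z + (T4 z + (T5 z + T6 z))))) := by
    intro z
    by_cases hzx : ‖z - x‖ < ballDefect x / 8
    swap
    · rw [kern_of_not_lt hzx, zero_mul]; exact zero_le
    by_cases hzy : ‖z - y‖ < ballDefect y / 8
    swap
    · rw [kern_of_not_lt hzy, mul_zero]; exact zero_le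
    have hz := mem_ball_of_near hx (by linarith : ‖z - x‖ < ballDefect x / 2)
    have hdz := ballDefect_pos hz
    have c1 := ballDefect_sub_le hx hz
    have c2 := ballDefect_sub_le hy hz
    rw [kern, kern, Set.indicator_of_mem (s := {z : E4 | ‖z - x‖ < ballDefect x / 8}) hzx,
      Set.indicator_of_mem (s := {z : E4 | ‖z - y‖ < ballDefect y / 8}) hzy]
    rw [← hD] at *
    set p := ‖z - x‖ with hp
    set q := ‖z - y‖ with hq
    have hp0 : 0 ≤ p := norm_nonneg _
    have hq0 : 0 ≤ q := norm_nonneg _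
    rw [← ENNReal.ofReal_mul (by positivity)]
    rcases hp0.eq_or_lt with hpz | hp0
    · rw [← hpz]; simp
    rcases hq0.eq_or_lt with hqz | hq0
    · rw [← hqz]; simp
    have hW := weight_mul_le hdx hdy hp0 hq0 hzx c1 c2
    have hpD : p < D := by linarith
    have hqD : q < D := by
      have := (abs_le.1 c1); have := (abs_le.1 c2); linarith
    have tri1 : δ ≤ p + q := by
      calc δ = ‖(z - x) - (z - y)‖ := by rw [hδ]; congr 1; abel
        _ ≤ _ := norm_sub_le _ _
    have tri2 : p ≤ q + δ := by
      calc p = ‖(z - y) + (y - x)‖ := by rw [hp]; congr 1; abel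
        _ ≤ _ := norm_add_le _ _
    have tri3 : q ≤ p + δ := by
      calc q = ‖(z - x) - (y - x)‖ := by rw [hq]; congr 1; abel
        _ ≤ _ := norm_sub_le _ _
    have hT5 : T5 z = ENNReal.ofReal (8 / D * (p ^ 3)⁻¹) := by
      simp only [T5]
      rw [Set.indicator_of_mem (s := {z : E4 | ‖z - x‖ < D}) hpD,
        ← ENNReal.ofReal_mul (by positivity)]
    have hT6 : T6 z = ENNReal.ofReal (8 / D * (q ^ 3)⁻¹) := by
      simp only [T6]
      rw [Set.indicator_of_mem (s := {z : E4 | ‖z - y‖ < D}) hqD,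
        ← ENNReal.ofReal_mul (by positivity)]
    have hfac : (4 * π ^ 2)⁻¹ * (D / ballDefect z) * (p ^ 2)⁻¹
          * ((4 * π ^ 2)⁻¹ * (ballDefect y / ballDefect z) * (q ^ 2)⁻¹)
        = (4 * π ^ 2)⁻¹ ^ 2 * ((D / ballDefect z) * (p ^ 2)⁻¹
          * ((ballDefect y / ballDefect z) * (q ^ 2)⁻¹)) := by ring
    rw [hfac, ENNReal.ofReal_mul (by positivity)]
    refine mul_le_mul_right ?_ _
    refine (ENNReal.ofReal_le_ofReal hW).trans ?_
    have hsplit : ENNReal.ofReal ((p ^ 2)⁻¹ * (q ^ 2)⁻¹) ≤ T1 z + (T2 z + (T3 z + T4 z)) := by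
      rcases le_or_gt (2 * δ) p with hfar | hnear
      · have hzS : z ∈ S := ⟨hfar, hpD⟩
        refine (ENNReal.ofReal_le_ofReal (inv_sq_mul_inv_sq_le_of_far hδ0 hfar
          (by linarith : p - δ ≤ q))).trans ?_
        rw [ENNReal.ofReal_add (by positivity) (by positivity),
          ENNReal.ofReal_mul (p := 6 * δ) (by positivity)]
        refine add_le_add (le_of_eq ?_) (le_trans (le_of_eq ?_) le_self_add)
        · simp only [T1]
          rw [Set.indicator_of_mem hzS]
        · simp only [T2]
          rw [Set.indicator_of_mem hzS]
      · refine (ENNReal.ofReal_le_ofReal (inv_sq_mul_inv_sq_le_of_near hδ0 hp0 hq0 tri1)).trans ?_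
        rw [ENNReal.ofReal_add (by positivity) (by positivity),
          ENNReal.ofReal_mul (p := 4 / δ ^ 2) (by positivity),
          ENNReal.ofReal_mul (p := 4 / δ ^ 2) (by positivity)]
        refine le_trans (le_of_eq ?_) (le_add_self.trans le_add_self)
        simp only [T3, T4]
        rw [Set.indicator_of_mem (s := {z : E4 | ‖z - x‖ < 2 * δ}) hnear,
          Set.indicator_of_mem (s := {z : E4 | ‖z - y‖ < 3 * δ}) (show q < 3 * δ by linarith)]
    rw [ENNReal.ofReal_add (by positivity) (by positivity),
      ENNReal.ofReal_add (by positivity) (by positivity), ← hT5, ← hT6]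
    calc _ ≤ T1 z + (T2 z + (T3 z + T4 z)) + T5 z + T6 z := by gcongr
      _ = _ := by ring
  have hlog0 : 0 ≤ log (D / (2 * δ)) := by
    refine log_nonneg ?_
    rw [le_div_iff₀ (by positivity)]; linarith
  have I1 : ∫⁻ z, T1 z = ENNReal.ofReal (2 * π ^ 2 * log (D / (2 * δ))) := by
    rw [lintegral_indicator hSm, lintegral_shell_norm_four_inv x (by positivity) (by linarith)]
  have I2 : ∫⁻ z, T2 z ≤ ENNReal.ofReal (6 * π ^ 2) := by
    rw [lintegral_const_mul' _ _ ENNReal.ofReal_ne_top, lintegral_indicator hSm]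
    refine (mul_le_mul_right (lintegral_shell_norm_five_inv_le x
      (by positivity : 0 < 2 * δ) (by linarith)) _).trans ?_
    rw [← ENNReal.ofReal_mul (by positivity)]
    refine le_of_eq (congrArg _ ?_)
    field_simp
  have I3 : ∫⁻ z, T3 z = ENNReal.ofReal (16 * π ^ 2) := by
    rw [lintegral_const_mul' _ _ ENNReal.ofReal_ne_top, lintegral_indicator (hbm _ _),
      lintegral_ball_norm_sq_inv x (by positivity), ← ENNReal.ofReal_mul (by positivity)]
    congr 1
    field_simp
    norm_num
  have I4 : ∫⁻ z, T4 z = ENNReal.ofReal (36 * π ^ 2) := by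
    rw [lintegral_const_mul' _ _ ENNReal.ofReal_ne_top, lintegral_indicator (hbm _ _),
      lintegral_ball_norm_sq_inv y (by positivity), ← ENNReal.ofReal_mul (by positivity)]
    congr 1
    field_simp
    norm_num
  have I5 : ∫⁻ z, T5 z = ENNReal.ofReal (16 * π ^ 2) := by
    rw [lintegral_const_mul' _ _ ENNReal.ofReal_ne_top, lintegral_indicator (hbm _ _),
      lintegral_ball_norm_cube_inv x hdx.le, ← ENNReal.ofReal_mul (by positivity)]
    congr 1
    field_simp
    norm_num
  have I6 : ∫⁻ z, T6 z = ENNReal.ofReal (16 * π ^ 2) := by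
    rw [lintegral_const_mul' _ _ ENNReal.ofReal_ne_top, lintegral_indicator (hbm _ _),
      lintegral_ball_norm_cube_inv y hdx.le, ← ENNReal.ofReal_mul (by positivity)]
    congr 1
    field_simp
    norm_num
  have hgram : gramKern x y ≤ ENNReal.ofReal ((4 * π ^ 2)⁻¹ ^ 2) *
      ENNReal.ofReal (2 * π ^ 2 * log (D / (2 * δ)) + 90 * π ^ 2) := by
    refine (lintegral_mono hpt).trans ?_
    rw [lintegral_const_mul' _ _ ENNReal.ofReal_ne_top]
    refine mul_le_mul_right ?_ _
    rw [lintegral_add_left m1, lintegral_add_left m2, lintegral_add_left m3, lintegral_add_left m4,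
      lintegral_add_left m5, I1, I3, I4, I5, I6]
    refine (add_le_add le_rfl (add_le_add I2 le_rfl)).trans ?_
    rw [← ENNReal.ofReal_add (by positivity) (by positivity),
      ← ENNReal.ofReal_add (by positivity) (by positivity),
      ← ENNReal.ofReal_add (by positivity) (by positivity),
      ← ENNReal.ofReal_add (by positivity) (by positivity),
      ← ENNReal.ofReal_add (mul_nonneg (by positivity) hlog0) (by positivity)]
    refine ENNReal.ofReal_le_ofReal ?_
    linarith
  refine (mul_le_mul_right hgram _).trans ?_
  have hs0 : 0 ≤ 2 * π ^ 2 * log (D / (2 * δ)) + 90 * π ^ 2 :=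
    add_nonneg (mul_nonneg (by positivity) hlog0) (by positivity)
  rw [← ENNReal.ofReal_mul (by positivity), ← ENNReal.ofReal_mul (by positivity)]
  refine ENNReal.ofReal_le_ofReal ?_
  have e : 32 * π ^ 2 * ((4 * π ^ 2)⁻¹ ^ 2 * (2 * π ^ 2 * log (D / (2 * δ)) + 90 * π ^ 2))
      = 4 * log (D / (2 * δ)) + 180 := by
    field_simp
    ring
  rw [e]
  have : log (D / (2 * δ)) ≤ log (D / δ) := by
    refine log_le_log (by positivity) ?_
    gcongr
    linarith
  linarith

/-- The hyperbolic volume on the unit ball. -/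
noncomputable def hypVol : Measure E4 :=
  (volume.restrict (Metric.ball (0 : E4) 1)).withDensity
    fun x => ENNReal.ofReal ((2 / ballDefect x) ^ 4)

lemma measurable_hypDensity : Measurable fun x => ENNReal.ofReal ((2 / ballDefect x) ^ 4) := by
  have := measurable_ballDefect
  fun_prop

lemma lintegral_hypVol {f : E4 → ENNReal} (hf : Measurable f) :
    ∫⁻ x, f x ∂hypVol
      = ∫⁻ x in Metric.ball (0 : E4) 1, ENNReal.ofReal ((2 / ballDefect x) ^ 4) * f x :=
  lintegral_withDensity_eq_lintegral_mul _ measurable_hypDensity hf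

lemma hypVol_absolutelyContinuous : hypVol ≪ volume :=
  (withDensity_absolutelyContinuous _ _).trans Measure.absolutelyContinuous_restrict

lemma ae_hypVol_mem_ball : ∀ᵐ x ∂hypVol, x ∈ Metric.ball (0 : E4) 1 :=
  (withDensity_absolutelyContinuous _ _).ae_le (ae_restrict_mem measurableSet_ball)

lemma log_le_two_mul_sqrt {s : ℝ} (hs : 0 < s) : log s ≤ 2 * √s := by
  have h1 := log_le_sub_one_of_pos (Real.sqrt_pos.2 hs)
  have h2 : log s = 2 * log √s := by
    rw [Real.log_sqrt hs.le]; ring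
  linarith

lemma lintegral_hypVol_near_le {x : E4} (hx : x ∈ Metric.ball (0 : E4) 1) {R : ℝ} (hR : 0 ≤ R) :
    ∫⁻ y, Set.indicator {y : E4 | ‖y - x‖ < R ∧ ‖y - x‖ < ballDefect x / 3}
        (fun y => ENNReal.ofReal ((‖y - x‖ ^ 2)⁻¹)) y ∂hypVol
      ≤ ENNReal.ofReal (1296 * π ^ 2 * R ^ 2 / ballDefect x ^ 4) := by
  have hd := ballDefect_pos hx
  have hm : MeasurableSet {y : E4 | ‖y - x‖ < R ∧ ‖y - x‖ < ballDefect x / 3} := by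
    rw [Set.ofPred_and]
    exact (measurableSet_lt (by fun_prop) (by fun_prop)).inter
      (measurableSet_lt (by fun_prop) (by fun_prop))
  rw [lintegral_hypVol (Measurable.indicator (by fun_prop) hm)]
  have hpt : ∀ y ∈ Metric.ball (0 : E4) 1, ENNReal.ofReal ((2 / ballDefect y) ^ 4)
      * Set.indicator {y : E4 | ‖y - x‖ < R ∧ ‖y - x‖ < ballDefect x / 3}
        (fun y => ENNReal.ofReal ((‖y - x‖ ^ 2)⁻¹)) y
      ≤ ENNReal.ofReal ((6 / ballDefect x) ^ 4) * Set.indicator {y : E4 | ‖y - x‖ < R}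
        (fun y => ENNReal.ofReal ((‖y - x‖ ^ 2)⁻¹)) y := by
    intro y hy
    by_cases hyR : y ∈ {y : E4 | ‖y - x‖ < R ∧ ‖y - x‖ < ballDefect x / 3}
    · rw [Set.indicator_of_mem hyR,
        Set.indicator_of_mem (show y ∈ {y : E4 | ‖y - x‖ < R} from hyR.1)]
      refine mul_le_mul_left (ENNReal.ofReal_le_ofReal ?_) _
      have hdy := ballDefect_pos hy
      have h1 := abs_le.1 (ballDefect_sub_le hx hy)
      have h2 : ‖y - x‖ < ballDefect x / 3 := hyR.2
      refine pow_le_pow_left₀ (by positivity) ?_ 4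
      rw [div_le_div_iff₀ hdy hd]
      linarith [h1.1]
    · rw [Set.indicator_of_notMem hyR, mul_zero]; exact zero_le
  refine (setLIntegral_mono' measurableSet_ball hpt).trans ?_
  refine (lintegral_mono' Measure.restrict_le_self le_rfl).trans ?_
  rw [lintegral_const_mul' _ _ ENNReal.ofReal_ne_top,
    lintegral_indicator (measurableSet_lt (by fun_prop) measurable_const),
    lintegral_ball_norm_sq_inv x hR, ← ENNReal.ofReal_mul (by positivity)]
  refine ENNReal.ofReal_le_ofReal (le_of_eq ?_)
  rw [div_pow]
  ring

/-- The potential of a set of small hyperbolic volume. -/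
lemma setLIntegral_gramKern_le {T : ℝ} (hT : 1 ≤ T) {E : Set E4} {t : ℝ}
    (ht : 0 < t) (htT : t ≤ T) (hEt : hypVol E = ENNReal.ofReal t) {x : E4}
    (hx : x ∈ Metric.ball (0 : E4) 1) :
    ENNReal.ofReal (32 * π ^ 2) * ∫⁻ y in E, gramKern x y ∂hypVol
      ≤ ENNReal.ofReal (t * (log (1 / t) + (180 + log T + 2592 * π ^ 2))) := by
  have hd := ballDefect_pos hx
  set D := ballDefect x with hD
  have hL0 : 0 ≤ log (1 / t) + (180 + log T) := by
    rw [one_div, log_inv]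
    have := log_le_log ht htT
    linarith
  set R : ℝ := √√t * D with hR
  have hsq : (√√t) ^ 4 = t := by
    rw [show 4 = 2 * 2 from rfl, pow_mul, Real.sq_sqrt (Real.sqrt_nonneg _), Real.sq_sqrt ht.le]
  have hpt : ∀ᵐ y ∂hypVol, ENNReal.ofReal (32 * π ^ 2) * gramKern x y
      ≤ ENNReal.ofReal (log (1 / t) + (180 + log T))
        + ENNReal.ofReal (2 * √t * D ^ 2)
          * Set.indicator {y : E4 | ‖y - x‖ < R ∧ ‖y - x‖ < D / 3}
              (fun y => ENNReal.ofReal ((‖y - x‖ ^ 2)⁻¹)) y := by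
    have hne : ∀ᵐ y ∂hypVol, y ≠ x := hypVol_absolutelyContinuous.ae_le (Measure.ae_ne volume x)
    filter_upwards [ae_hypVol_mem_ball, hne] with y hy hyx
    by_cases hfar : D / 3 ≤ ‖y - x‖
    · rw [gramKern_eq_zero hx hy hfar, mul_zero]; exact zero_le
    rw [not_le] at hfar
    refine (gramKern_le hx hy hyx hfar).trans ?_
    have hδ : 0 < ‖y - x‖ := norm_pos_iff.2 (sub_ne_zero.2 hyx)
    have hlogT := log_nonneg hT
    have e4 : 4 * log (D / ‖y - x‖) = log (1 / t) + log (t * (D / ‖y - x‖) ^ 4) := by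
      rw [log_mul ht.ne' (by positivity), Real.log_pow, one_div, log_inv]
      push_cast; ring
    by_cases hyR : ‖y - x‖ < R
    · rw [Set.indicator_of_mem (show y ∈ {y : E4 | ‖y - x‖ < R ∧ ‖y - x‖ < D / 3} from ⟨hyR, hfar⟩),
        ← ENNReal.ofReal_mul (by positivity), ← ENNReal.ofReal_add hL0 (by positivity)]
      refine ENNReal.ofReal_le_ofReal ?_
      have h1 := log_le_two_mul_sqrt (s := t * (D / ‖y - x‖) ^ 4) (by positivity)
      have h2 : √(t * (D / ‖y - x‖) ^ 4) = √t * D ^ 2 * (‖y - x‖ ^ 2)⁻¹ := by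
        rw [Real.sqrt_mul ht.le, show (D / ‖y - x‖) ^ 4 = ((D / ‖y - x‖) ^ 2) ^ 2 by ring,
          Real.sqrt_sq (by positivity), div_pow]
        ring
      rw [h2] at h1
      linarith
    · rw [Set.indicator_of_notMem
        (show y ∉ {y : E4 | ‖y - x‖ < R ∧ ‖y - x‖ < D / 3} from fun h => hyR h.1),
        mul_zero, add_zero]
      refine ENNReal.ofReal_le_ofReal ?_
      have h1 : log (t * (D / ‖y - x‖) ^ 4) ≤ 0 := by
        refine log_nonpos (by positivity) ?_
        rw [not_lt, hR] at hyR
        have h3 : √√t * (D / ‖y - x‖) ≤ 1 := by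
          rw [← mul_div_assoc, div_le_one hδ]; exact hyR
        have h4 := pow_le_one₀ (n := 4) (by positivity) h3
        rwa [mul_pow, hsq] at h4
      linarith
  have hR0 : 0 ≤ R := by positivity
  have hm : MeasurableSet {y : E4 | ‖y - x‖ < R ∧ ‖y - x‖ < D / 3} := by
    rw [Set.ofPred_and]
    exact (measurableSet_lt (by fun_prop) (by fun_prop)).inter
      (measurableSet_lt (by fun_prop) (by fun_prop))
  rw [← lintegral_const_mul' _ _ ENNReal.ofReal_ne_top]
  refine (lintegral_mono_ae (ae_restrict_of_ae hpt)).trans ?_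
  rw [lintegral_add_left measurable_const, lintegral_const_mul' _ _ ENNReal.ofReal_ne_top,
    lintegral_const, Measure.restrict_apply_univ, hEt]
  refine (add_le_add le_rfl (mul_le_mul_right
    ((lintegral_mono' Measure.restrict_le_self le_rfl).trans
    (lintegral_hypVol_near_le hx hR0)) _)).trans ?_
  rw [← ENNReal.ofReal_mul hL0, ← ENNReal.ofReal_mul (by positivity),
    ← ENNReal.ofReal_add (by positivity) (by positivity)]
  refine ENNReal.ofReal_le_ofReal (le_of_eq ?_)
  have e1 : R ^ 2 = √t * D ^ 2 := by
    rw [hR, mul_pow, Real.sq_sqrt (Real.sqrt_nonneg _)]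
  rw [← hD, e1]
  have e2 : 2 * √t * D ^ 2 * (1296 * π ^ 2 * (√t * D ^ 2) / D ^ 4) = 2592 * π ^ 2 * (√t * √t) := by
    field_simp
    ring
  rw [e2, Real.mul_self_sqrt ht.le]
  ring

instance : SFinite hypVol := by unfold hypVol; infer_instance

lemma measurable_kern_left (z : E4) : Measurable fun x => kern x z :=
  Measurable.of_uncurry_right (f := kern) measurable_kern

lemma measurable_kern_right (x : E4) : Measurable fun z => kern x z :=
  Measurable.of_uncurry_left (f := kern) measurable_kern

lemma measurable_kern_swap : Measurable fun p : E4 × E4 => kern p.2 p.1 :=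
  (measurable_kern.comp measurable_swap :)

/-- The potential of a set with respect to `kern`. -/
noncomputable def kernPotential (E : Set E4) (z : E4) : ENNReal := ∫⁻ x in E, kern x z ∂hypVol

lemma measurable_kernPotential (E : Set E4) : Measurable (kernPotential E) :=
  Measurable.lintegral_prod_left' (f := fun p : E4 × E4 => kern p.1 p.2) measurable_kern

lemma lintegral_kernPotential_mul (E F : Set E4) :
    ∫⁻ z, kernPotential E z * kernPotential F z
      = ∫⁻ x in F, ∫⁻ y in E, gramKern x y ∂hypVol ∂hypVol := by
  calc ∫⁻ z, kernPotential E z * kernPotential F z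
      = ∫⁻ z, ∫⁻ x in F, kernPotential E z * kern x z ∂hypVol := by
        refine lintegral_congr fun z => ?_
        rw [lintegral_const_mul _ (measurable_kern_left z)]
        rfl
    _ = ∫⁻ x in F, (∫⁻ z, kernPotential E z * kern x z) ∂hypVol := by
        refine lintegral_lintegral_swap (Measurable.aemeasurable ?_)
        exact ((measurable_kernPotential E).comp measurable_fst).mul measurable_kern_swap
    _ = ∫⁻ x in F, (∫⁻ z, ∫⁻ y in E, kern x z * kern y z ∂hypVol) ∂hypVol := by
        refine lintegral_congr fun x => lintegral_congr fun z => ?_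
        rw [mul_comm, lintegral_const_mul _ (measurable_kern_left z)]
        rfl
    _ = _ := by
        refine lintegral_congr fun x => ?_
        refine lintegral_lintegral_swap (Measurable.aemeasurable ?_)
        exact ((measurable_kern_right x).comp measurable_fst).mul measurable_kern_swap

lemma measurable_source {u : E4 → ℝ} (hu : IsBallTest u) : Measurable (source u) := by
  have h1 := measurable_ballDefect
  have h2 := hu.gapOp.smooth.continuous.measurable
  unfold source
  fun_prop

lemma lintegral_source_sq {u : E4 → ℝ} (hu : IsBallTest u) :
    ∫⁻ z, source u z ^ 2 = ENNReal.ofReal (∫ z, gapOp u z ^ 2 * (2 / ballDefect z) ^ 4) := by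
  have hi : IsBallTest fun z => gapOp u z ^ 2 * (2 / ballDefect z) ^ 4 := by
    convert (hu.gapOp.mul hu.gapOp).mul_weight using 2
    ring
  rw [ofReal_integral_eq_lintegral_ofReal hi.integrable
    (Filter.Eventually.of_forall fun z => by positivity)]
  refine lintegral_congr fun z => ?_
  rw [source, ← ENNReal.ofReal_pow (by positivity), div_pow, mul_pow, sq_abs, div_pow]
  congr 1
  ring

lemma mul_le_potential {u : E4 → ℝ} (hu : IsBallTest u) {E : Set E4} (hE : MeasurableSet E)
    (hEb : E ⊆ Metric.ball 0 1) {e s : ℝ}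
    (hrep : ∀ x ∈ Metric.ball (0 : E4) 1,
      ENNReal.ofReal |u x| ≤ (∫⁻ z, kern x z * source u z) + ENNReal.ofReal e)
    (hs : ∀ x ∈ E, s ≤ |u x|) :
    ENNReal.ofReal s * hypVol E
      ≤ (∫⁻ z, kernPotential E z * source u z) + ENNReal.ofReal e * hypVol E := by
  have hsw : (∫⁻ x in E, (∫⁻ z, kern x z * source u z) ∂hypVol)
      = ∫⁻ z, kernPotential E z * source u z := by
    rw [lintegral_lintegral_swap (Measurable.aemeasurable
      (measurable_kern.mul ((measurable_source hu).comp measurable_snd)))]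
    refine lintegral_congr fun z => ?_
    rw [lintegral_mul_const _ (measurable_kern_left z)]
    rfl
  calc ENNReal.ofReal s * hypVol E = ∫⁻ _ in E, ENNReal.ofReal s ∂hypVol := by
        rw [setLIntegral_const]
    _ ≤ ∫⁻ x in E, ((∫⁻ z, kern x z * source u z) + ENNReal.ofReal e) ∂hypVol :=
        setLIntegral_mono' hE fun x hx =>
          (ENNReal.ofReal_le_ofReal (hs x hx)).trans (hrep x (hEb hx))
    _ = _ := by
        rw [lintegral_add_right _ measurable_const, hsw, setLIntegral_const]

lemma add_sqrt_mul_sq_le {J P D G e m : ℝ} (hJ : 0 ≤ J) (hP : 0 ≤ P) (hD : 0 ≤ D) (hG : 0 ≤ G)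
    (he : 0 ≤ e) (hm : 0 < m) (h : P + m * D ≤ 1) (hJP : J ^ 2 ≤ P * G) :
    (J + √D * e) ^ 2 ≤ G + e ^ 2 / m := by
  have h1 : J ≤ √P * √G := by
    rw [← Real.sqrt_mul hP]; exact Real.le_sqrt_of_sq_le hJP
  have h2 : √D * e = √(m * D) * (e / √m) := by
    rw [Real.sqrt_mul hm.le]
    have := Real.sqrt_pos.2 hm
    field_simp
  have h3 : (J + √D * e) ^ 2 ≤ (√P * √G + √(m * D) * (e / √m)) ^ 2 := by
    rw [← h2]
    exact pow_le_pow_left₀ (by positivity) (by linarith) 2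
  have h4 : (√P * √G + √(m * D) * (e / √m)) ^ 2 ≤ (P + m * D) * (G + e ^ 2 / m) := by
    have e1 : √P ^ 2 = P := Real.sq_sqrt hP
    have e2 : √G ^ 2 = G := Real.sq_sqrt hG
    have e3 : √(m * D) ^ 2 = m * D := Real.sq_sqrt (by positivity)
    have e4 : e ^ 2 / m = (e / √m) ^ 2 := by rw [div_pow, Real.sq_sqrt hm.le]
    calc _ ≤ (√P ^ 2 + √(m * D) ^ 2) * (√G ^ 2 + (e / √m) ^ 2) := by
          nlinarith [sq_nonneg (√P * (e / √m) - √(m * D) * √G)]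
      _ = _ := by rw [e1, e2, e3, e4]
  have h5 : (P + m * D) * (G + e ^ 2 / m) ≤ 1 * (G + e ^ 2 / m) :=
    mul_le_mul_of_nonneg_right h (by positivity)
  linarith

/-- The mass of the potential of `F` over `E`. -/
lemma lintegral_kernPotential_mul_le {T : ℝ} (hT : 1 ≤ T) {E F : Set E4} (hF : MeasurableSet F)
    (hFb : F ⊆ Metric.ball 0 1) {t r : ℝ} (ht : 0 < t) (htT : t ≤ T) (hr : 0 ≤ r)
    (hE : hypVol E = ENNReal.ofReal t) (hFr : hypVol F = ENNReal.ofReal r) :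
    ENNReal.ofReal (32 * π ^ 2) * ∫⁻ z, kernPotential E z * kernPotential F z
      ≤ ENNReal.ofReal (t * r * (log (1 / t) + (180 + log T + 2592 * π ^ 2))) := by
  rw [lintegral_kernPotential_mul, ← lintegral_const_mul' _ _ ENNReal.ofReal_ne_top]
  refine (setLIntegral_mono' hF fun x hx =>
    setLIntegral_gramKern_le hT ht htT hE (hFb hx)).trans ?_
  rw [setLIntegral_const, hFr, ← ENNReal.ofReal_mul' hr]
  exact ENNReal.ofReal_le_ofReal (le_of_eq (by ring))

lemma exists_gram_bound {m T : ℝ} (hm : 0 < m) (hT : 1 ≤ T) :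
    ∃ C : ℝ, 0 ≤ C ∧ ∀ u : E4 → ℝ, IsBallTest u →
      (∫ x, gapOp u x ^ 2 * (2 / ballDefect x) ^ 4) + m * gapForm u ≤ 1 →
      ∀ (E F : Set E4) (t r s s' a c : ℝ), MeasurableSet E → MeasurableSet F →
        E ⊆ Metric.ball 0 1 → F ⊆ Metric.ball 0 1 → 0 < t → t ≤ T → 0 < r → r ≤ T →
        hypVol E = ENNReal.ofReal t → hypVol F = ENNReal.ofReal r →
        (∀ x ∈ E, s ≤ |u x|) → (∀ x ∈ F, s' ≤ |u x|) → 0 ≤ s → 0 ≤ s' → 0 ≤ a → 0 ≤ c →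
        32 * π ^ 2 * (a * s + c * s') ^ 2
          ≤ (a ^ 2 + 2 * a * c) * (log (1 / t) + C) + c ^ 2 * (log (1 / r) + C) := by
  obtain ⟨c₀, hc₀, hrep⟩ := exists_representation
  set K : ℝ := 180 + log T + 2592 * π ^ 2 with hK
  have hlogT := log_nonneg hT
  refine ⟨K + 32 * π ^ 2 * c₀ ^ 2 / m, by positivity, ?_⟩
  intro u hu hen E F t r s s' a c hEm hFm hEb hFb ht htT hr hrT hE hF hsE hsF hs hs' ha hc
  set P := ∫ x, gapOp u x ^ 2 * (2 / ballDefect x) ^ 4 with hP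
  have hP0 : 0 ≤ P := integral_nonneg fun x => by positivity
  have hD0 := hu.gapForm_nonneg
  set e := c₀ * √(gapForm u) with he
  set H : E4 → ENNReal := fun z => ENNReal.ofReal (a / t) * kernPotential E z
    + ENNReal.ofReal (c / r) * kernPotential F z with hH
  have mE := measurable_kernPotential E
  have mF := measurable_kernPotential F
  have mS := measurable_source hu
  have mH : Measurable H := (mE.const_mul _).add (mF.const_mul _)
  have hxpos : ∀ {τ : ℝ}, 0 < τ → τ ≤ T → 0 ≤ log (1 / τ) + K := by
    intro τ h1 h2
    rw [one_div, log_inv]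
    have := log_le_log h1 h2
    have : 0 ≤ 2592 * π ^ 2 := by positivity
    linarith
  have hx1 := hxpos ht htT
  have hx2 := hxpos hr hrT
  set G : ℝ := a ^ 2 * (log (1 / t) + K) + 2 * a * c * (log (1 / t) + K)
    + c ^ 2 * (log (1 / r) + K) with hG
  have hG0 : 0 ≤ G := by positivity
  have hb : (0 : ℝ) < 32 * π ^ 2 := by positivity
  -- the quadratic form of the combined potential
  have hHH : ENNReal.ofReal (32 * π ^ 2) * ∫⁻ z, H z ^ 2 ≤ ENNReal.ofReal G := by
    have hexp : ∀ z, H z ^ 2 = ENNReal.ofReal (a / t) ^ 2 * (kernPotential E z * kernPotential E z)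
        + (2 * ENNReal.ofReal (a / t) * ENNReal.ofReal (c / r)
            * (kernPotential E z * kernPotential F z)
          + ENNReal.ofReal (c / r) ^ 2 * (kernPotential F z * kernPotential F z)) := by
      intro z; simp only [hH]; ring
    simp only [hexp]
    rw [lintegral_add_left (by fun_prop), lintegral_add_left (by fun_prop),
      lintegral_const_mul _ (by fun_prop), lintegral_const_mul _ (by fun_prop),
      lintegral_const_mul _ (by fun_prop)]
    have hEE := lintegral_kernPotential_mul_le hT hEm hEb ht htT ht.le hE hE
    have hEF := lintegral_kernPotential_mul_le hT hFm hFb ht htT hr.le hE hF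
    have hFF := lintegral_kernPotential_mul_le hT hFm hFb hr hrT hr.le hF hF
    calc _ = ENNReal.ofReal (a / t) ^ 2
          * (ENNReal.ofReal (32 * π ^ 2) * ∫⁻ z, kernPotential E z * kernPotential E z)
        + (2 * ENNReal.ofReal (a / t) * ENNReal.ofReal (c / r)
          * (ENNReal.ofReal (32 * π ^ 2) * ∫⁻ z, kernPotential E z * kernPotential F z)
        + ENNReal.ofReal (c / r) ^ 2
          * (ENNReal.ofReal (32 * π ^ 2) * ∫⁻ z, kernPotential F z * kernPotential F z)) := by
          ring
      _ ≤ _ := add_le_add (mul_le_mul_right hEE _)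
          (add_le_add (mul_le_mul_right hEF _) (mul_le_mul_right hFF _))
      _ = ENNReal.ofReal G := by
          have h2 : (2 : ENNReal) = ENNReal.ofReal 2 := by norm_num
          rw [h2, ← ENNReal.ofReal_pow (by positivity), ← ENNReal.ofReal_pow (by positivity),
            ← ENNReal.ofReal_mul (by positivity), ← ENNReal.ofReal_mul (by positivity),
            ← ENNReal.ofReal_mul (by positivity), ← ENNReal.ofReal_mul (by positivity),
            ← ENNReal.ofReal_mul (by positivity), ← ENNReal.ofReal_add (by positivity)
              (by positivity), ← ENNReal.ofReal_add (by positivity) (by positivity)]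
          congr 1
          rw [hG, ← hK]
          field_simp
          ring
  -- duality
  have hpair : ENNReal.ofReal (a * s + c * s')
      ≤ (∫⁻ z, H z * source u z) + ENNReal.ofReal (e * (a + c)) := by
    have key : ∀ {E : Set E4} {t s a : ℝ}, MeasurableSet E → E ⊆ Metric.ball 0 1 → 0 < t →
        0 ≤ a → 0 ≤ s → hypVol E = ENNReal.ofReal t → (∀ x ∈ E, s ≤ |u x|) →
        ENNReal.ofReal (a * s) ≤ ENNReal.ofReal (a / t) * (∫⁻ z, kernPotential E z * source u z)
          + ENNReal.ofReal (a * e) := by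
      intro E t s a hEm hEb ht ha hs hE hsE
      have h := mul_le_mul_right (mul_le_potential hu hEm hEb (hrep u hu) hsE)
        (ENNReal.ofReal (a / t))
      rw [mul_add, hE, ← ENNReal.ofReal_mul hs, ← ENNReal.ofReal_mul (by positivity),
        ← ENNReal.ofReal_mul (by positivity), ← ENNReal.ofReal_mul (by positivity)] at h
      rwa [show a / t * (s * t) = a * s by field_simp,
        show a / t * (c₀ * √(gapForm u) * t) = a * e by rw [he]; field_simp] at h
    have h1 := key hEm hEb ht ha hs hE hsE
    have h2 := key hFm hFb hr hc hs' hF hsF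
    rw [ENNReal.ofReal_add (by positivity) (by positivity)]
    refine (add_le_add h1 h2).trans (le_of_eq ?_)
    have hsplit : ∫⁻ z, H z * source u z
        = ENNReal.ofReal (a / t) * (∫⁻ z, kernPotential E z * source u z)
          + ENNReal.ofReal (c / r) * (∫⁻ z, kernPotential F z * source u z) := by
      simp only [hH, add_mul, mul_assoc]
      rw [lintegral_add_left (by fun_prop), lintegral_const_mul _ (by fun_prop),
        lintegral_const_mul _ (by fun_prop)]
    rw [hsplit, show e * (a + c) = a * e + c * e by ring,
      ENNReal.ofReal_add (by positivity) (by positivity)]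
    ring
  have hJ2 := lintegral_mul_sq_le (μ := volume) mH.aemeasurable mS.aemeasurable
  rw [lintegral_source_sq hu, ← hP] at hJ2
  set J := ∫⁻ z, H z * source u z with hJ
  have hbJ : ENNReal.ofReal (32 * π ^ 2) * J ^ 2 ≤ ENNReal.ofReal (P * G) := by
    rw [mul_comm P G, ENNReal.ofReal_mul hG0]
    calc _ ≤ ENNReal.ofReal (32 * π ^ 2) * ((∫⁻ z, H z ^ 2) * ENNReal.ofReal P) :=
          mul_le_mul_right hJ2 _
      _ = ENNReal.ofReal (32 * π ^ 2) * (∫⁻ z, H z ^ 2) * ENNReal.ofReal P := by ring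
      _ ≤ _ := mul_le_mul_left hHH _
  have hJtop : J ≠ ⊤ := by
    intro h
    rw [h, ENNReal.top_pow (by norm_num), ENNReal.mul_top (by simp)] at hbJ
    exact ENNReal.ofReal_ne_top (top_le_iff.1 hbJ)
  obtain ⟨j, hj0, hj⟩ : ∃ j : ℝ, 0 ≤ j ∧ J = ENNReal.ofReal j :=
    ⟨J.toReal, ENNReal.toReal_nonneg, (ENNReal.ofReal_toReal hJtop).symm⟩
  rw [hj, ← ENNReal.ofReal_pow hj0, ← ENNReal.ofReal_mul hb.le,
    ENNReal.ofReal_le_ofReal_iff (by positivity)] at hbJ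
  rw [hj, ← ENNReal.ofReal_add hj0 (by positivity),
    ENNReal.ofReal_le_ofReal_iff (by positivity)] at hpair
  have hfin := add_sqrt_mul_sq_le (G := G / (32 * π ^ 2)) (e := c₀ * (a + c)) hj0 hP0 hD0
    (by positivity) (by positivity) hm hen (by
      rw [mul_div_assoc', le_div_iff₀ hb]; linarith)
  have h1 : (a * s + c * s') ^ 2 ≤ (j + √(gapForm u) * (c₀ * (a + c))) ^ 2 := by
    refine pow_le_pow_left₀ (by positivity) (hpair.trans (le_of_eq ?_)) 2
    rw [he]; ring
  have h2 := mul_le_mul_of_nonneg_left (h1.trans hfin) hb.le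
  refine h2.trans (le_of_eq ?_)
  rw [hG]
  field_simp
  ring

lemma card_le_of_sqrt_gap {S : Finset ℕ} {l : ℕ}
    (h : ∀ i ∈ S, ∀ j ∈ S, i < j → √(i : ℝ) * (√(j : ℝ) - √(i : ℝ)) ≤ 2 * l) :
    S.card ≤ 8 * l + 2 := by
  set B := S.filter fun k => 2 * l < k with hB
  have hsplit : S ⊆ Finset.Icc 0 (2 * l) ∪ B := by
    intro k hk
    simp only [hB, Finset.mem_union, Finset.mem_Icc, Finset.mem_filter, hk, true_and]
    omega
  have hBcard : B.card ≤ 6 * l + 1 := by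
    rcases B.eq_empty_or_nonempty with h0 | hne
    · simp [h0]
    set i := B.min' hne with hi
    have hiB : i ∈ B := B.min'_mem hne
    have hsub : B ⊆ Finset.Icc i (i + 6 * l) := by
      intro j hj
      have hij : i ≤ j := B.min'_le j hj
      rw [Finset.mem_Icc]
      refine ⟨hij, ?_⟩
      rcases hij.eq_or_lt with he | hlt
      · omega
      rw [hB, Finset.mem_filter] at hj hiB
      have hg := h i hiB.1 j hj.1 hlt
      have hi2 : (2 * l : ℝ) < i := by exact_mod_cast hiB.2
      have e1 : √(i : ℝ) ^ 2 = i := Real.sq_sqrt (Nat.cast_nonneg i)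
      have e2 : √(j : ℝ) ^ 2 = j := Real.sq_sqrt (Nat.cast_nonneg j)
      have hr0 : 0 ≤ √(i : ℝ) := Real.sqrt_nonneg _
      have hle : √(i : ℝ) ≤ √(j : ℝ) := Real.sqrt_le_sqrt (by exact_mod_cast hij)
      have hlt2 : √(j : ℝ) < 2 * √(i : ℝ) := by
        by_contra hc
        rw [not_lt] at hc
        nlinarith
      have : (j : ℝ) ≤ i + 6 * l := by nlinarith
      exact_mod_cast this
    have := Finset.card_le_card hsub
    rw [Nat.card_Icc] at this
    omega
  have h1 := (Finset.card_le_card hsplit).trans (Finset.card_union_le _ _)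
  rw [Nat.card_Icc] at h1
  omega

lemma exists_sum_exp_neg_le :
    ∃ C : ℝ, 0 ≤ C ∧ ∀ (A : Finset ℕ) (δ : ℕ → ℝ), (∀ k ∈ A, 0 ≤ δ k) →
      (∀ i ∈ A, ∀ j ∈ A, i < j → 2 * (√(i : ℝ) * (√(j : ℝ) - √(i : ℝ))) ≤ 3 * δ i + δ j) →
      ∑ k ∈ A, exp (-δ k) ≤ C := by
  have hsum : Summable fun j : ℕ => (8 * (j : ℝ) + 10) * exp (-(j : ℝ)) := by
    have h1 := (Real.summable_pow_mul_exp_neg_nat_mul 1 one_pos).mul_left 8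
    have h0 := (Real.summable_pow_mul_exp_neg_nat_mul 0 one_pos).mul_left 10
    refine (h1.add h0).congr fun j => ?_
    rw [pow_one, pow_zero, neg_one_mul]
    ring
  refine ⟨∑' j : ℕ, (8 * (j : ℝ) + 10) * exp (-(j : ℝ)), tsum_nonneg fun j => by positivity, ?_⟩
  intro A δ hδ hgap
  set I := A.image fun k => ⌊δ k⌋₊ with hI
  have hfib := Finset.sum_fiberwise_of_maps_to (s := A) (t := I) (g := fun k => ⌊δ k⌋₊)
    (fun k hk => Finset.mem_image_of_mem _ hk) fun k => exp (-δ k)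
  rw [← hfib]
  refine le_trans (Finset.sum_le_sum fun j _ => ?_)
    (hsum.sum_le_tsum I fun j _ => by positivity)
  have hcard : (A.filter fun k => ⌊δ k⌋₊ = j).card ≤ 8 * (j + 1) + 2 := by
    refine card_le_of_sqrt_gap fun a ha b hb hab => ?_
    rw [Finset.mem_filter] at ha hb
    have ha2 := Nat.lt_floor_add_one (δ a)
    have hb2 := Nat.lt_floor_add_one (δ b)
    rw [ha.2] at ha2
    rw [hb.2] at hb2
    have := hgap a ha.1 b hb.1 hab
    push_cast
    linarith
  calc ∑ k ∈ A with ⌊δ k⌋₊ = j, exp (-δ k)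
      ≤ ∑ k ∈ A with ⌊δ k⌋₊ = j, exp (-(j : ℝ)) := by
        refine Finset.sum_le_sum fun k hk => ?_
        rw [Finset.mem_filter] at hk
        have := Nat.floor_le (hδ k hk.1)
        rw [hk.2] at this
        exact exp_le_exp.2 (by linarith)
    _ = (A.filter fun k => ⌊δ k⌋₊ = j).card * exp (-(j : ℝ)) := by
        rw [Finset.sum_const, nsmul_eq_mul]
    _ ≤ _ := by
        refine mul_le_mul_of_nonneg_right ?_ (exp_pos _).le
        have : ((A.filter fun k => ⌊δ k⌋₊ = j).card : ℝ) ≤ (8 * (j + 1) + 2 : ℕ) := by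
          exact_mod_cast hcard
        push_cast at this
        linarith

lemma exp_sub_one_sub_le_sum {N : ℝ} {n : ℕ} (hN : 0 ≤ N) (hNn : N ≤ n) :
    exp N - 1 - N ≤ N ^ 2 + ∑ k ∈ Finset.Icc 1 n, if (k : ℝ) ≤ N then exp (k + 1) else 0 := by
  have hterm : ∀ k ∈ Finset.Icc 1 n, 0 ≤ if (k : ℝ) ≤ N then exp ((k : ℝ) + 1) else 0 := by
    intro k _
    split_ifs <;> positivity
  rcases lt_or_ge N 1 with h1 | h1
  · have := (abs_le.1 (Real.abs_exp_sub_one_sub_id_le (abs_le.2 ⟨by linarith, h1.le⟩))).2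
    have := Finset.sum_nonneg hterm
    linarith
  · have hfl := Nat.floor_le hN
    have hmem : ⌊N⌋₊ ∈ Finset.Icc 1 n := by
      rw [Finset.mem_Icc]
      refine ⟨Nat.le_floor (by exact_mod_cast h1), ?_⟩
      exact_mod_cast hfl.trans hNn
    have h2 := Finset.single_le_sum hterm hmem
    rw [if_pos hfl] at h2
    have h3 : exp N ≤ exp ((⌊N⌋₊ : ℝ) + 1) := exp_le_exp.2 (Nat.lt_floor_add_one N).le
    nlinarith [sq_nonneg N]

lemma lintegral_ofReal_hypVol {f : E4 → ℝ} (hf : Measurable f) :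
    ∫⁻ x, ENNReal.ofReal (f x) ∂hypVol
      = ∫⁻ x in Metric.ball (0 : E4) 1, ENNReal.ofReal ((2 / ballDefect x) ^ 4 * f x) := by
  rw [lintegral_hypVol (by fun_prop)]
  refine lintegral_congr fun x => ?_
  rw [ENNReal.ofReal_mul (by positivity)]

lemma exists_lintegral_sq_le {m : ℝ} (hm : 0 < m) :
    ∃ C : ℝ, 0 < C ∧ ∀ u : E4 → ℝ, IsBallTest u →
      (∫ x, gapOp u x ^ 2 * (2 / ballDefect x) ^ 4) + m * gapForm u ≤ 1 →
      ∫⁻ x, ENNReal.ofReal ((32 * π ^ 2 * u x ^ 2) ^ 2) ∂hypVol ≤ ENNReal.ofReal C := by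
  obtain ⟨S, hS, hsob⟩ := exists_sobolev_const
  refine ⟨16 * (32 * π ^ 2) ^ 2 * (S * (1 / m) ^ 2), by positivity, fun u hu hen => ?_⟩
  have hD0 := hu.gapForm_nonneg
  have hDm : gapForm u ≤ 1 / m := by
    have hP0 : 0 ≤ ∫ x, gapOp u x ^ 2 * (2 / ballDefect x) ^ 4 :=
      integral_nonneg fun x => by positivity
    rw [le_div_iff₀ hm]
    linarith
  have hum := hu.smooth.continuous.measurable
  rw [lintegral_ofReal_hypVol (by fun_prop)]
  refine (lintegral_mono' Measure.restrict_le_self le_rfl).trans ?_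
  have hq : IsBallTest fun x => (u x / ballDefect x) ^ 4 := by
    convert ((hu.mul hu).mul (hu.mul hu)).div_pow 4 using 2
    rw [div_pow]
    ring
  have hpt : ∀ x, (2 / ballDefect x) ^ 4 * (32 * π ^ 2 * u x ^ 2) ^ 2
      = 16 * (32 * π ^ 2) ^ 2 * (u x / ballDefect x) ^ 4 := by
    intro x
    rw [div_pow, div_pow]
    ring
  simp only [hpt]
  rw [← ofReal_integral_eq_lintegral_ofReal (hq.integrable.const_mul _)
    (Filter.Eventually.of_forall fun x => by positivity), integral_const_mul]
  refine ENNReal.ofReal_le_ofReal ?_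
  refine mul_le_mul_of_nonneg_left ((hsob u hu).trans ?_) (by positivity)
  gcongr

lemma exists_sum_exp_mul_hypVol_le {m : ℝ} (hm : 0 < m) :
    ∃ C : ℝ, 0 ≤ C ∧ ∀ u : E4 → ℝ, IsBallTest u →
      (∫ x, gapOp u x ^ 2 * (2 / ballDefect x) ^ 4) + m * gapForm u ≤ 1 → ∀ n : ℕ,
      ∑ k ∈ Finset.Icc 1 n, ENNReal.ofReal (exp k)
        * hypVol (Metric.ball 0 1 ∩ {x | (k : ℝ) ≤ 32 * π ^ 2 * u x ^ 2}) ≤ ENNReal.ofReal C := by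
  obtain ⟨C₂, hC₂, hsq⟩ := exists_lintegral_sq_le hm
  obtain ⟨C₀, hC₀, hgram⟩ := exists_gram_bound hm (T := 1 + C₂) (by linarith)
  obtain ⟨C₁, hC₁, hsum⟩ := exists_sum_exp_neg_le
  refine ⟨exp C₀ * C₁, by positivity, fun u hu hen n => ?_⟩
  set E : ℕ → Set E4 := fun k => Metric.ball 0 1 ∩ {x | (k : ℝ) ≤ 32 * π ^ 2 * u x ^ 2} with hE
  have hum := hu.smooth.continuous.measurable
  have hEm : ∀ k, MeasurableSet (E k) := fun k =>
    measurableSet_ball.inter (measurableSet_le (by fun_prop) (by fun_prop))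
  have hb : (0 : ℝ) < 32 * π ^ 2 := by positivity
  have hvol : ∀ k, 1 ≤ k → hypVol (E k) ≤ ENNReal.ofReal C₂ := by
    intro k hk
    have hk1 : (1 : ℝ) ≤ k := by exact_mod_cast hk
    refine le_trans ?_ (hsq u hu hen)
    calc hypVol (E k) = ∫⁻ _ in E k, 1 ∂hypVol := by rw [setLIntegral_const, one_mul]
      _ ≤ ∫⁻ x in E k, ENNReal.ofReal ((32 * π ^ 2 * u x ^ 2) ^ 2) ∂hypVol := by
          refine setLIntegral_mono' (hEm k) fun x hx => ?_
          rw [ENNReal.one_le_ofReal]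
          exact one_le_pow₀ (hk1.trans hx.2)
      _ ≤ _ := lintegral_mono' Measure.restrict_le_self le_rfl
  set t : ℕ → ℝ := fun k => (hypVol (E k)).toReal with ht
  have hEt : ∀ k, 1 ≤ k → hypVol (E k) = ENNReal.ofReal (t k) := fun k hk =>
    (ENNReal.ofReal_toReal (ne_top_of_le_ne_top ENNReal.ofReal_ne_top (hvol k hk))).symm
  have htT : ∀ k, 1 ≤ k → t k ≤ 1 + C₂ := by
    intro k hk
    have := ENNReal.toReal_le_of_le_ofReal hC₂.le (hvol k hk)
    linarith
  set A : Finset ℕ := (Finset.Icc 1 n).filter fun k => 0 < t k with hA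
  set δ : ℕ → ℝ := fun k => log (1 / t k) + C₀ - k with hδ
  have hs : ∀ k : ℕ, ∀ x ∈ E k, √((k : ℝ) / (32 * π ^ 2)) ≤ |u x| := by
    intro k x hx
    rw [← Real.sqrt_sq_eq_abs]
    refine Real.sqrt_le_sqrt ?_
    rw [div_le_iff₀ hb]
    have : (k : ℝ) ≤ 32 * π ^ 2 * u x ^ 2 := hx.2
    linarith
  have hpair : ∀ i ∈ A, ∀ j ∈ A, (√(i : ℝ) + √(j : ℝ)) ^ 2
      ≤ 3 * (log (1 / t i) + C₀) + (log (1 / t j) + C₀) := by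
    intro i hi j hj
    rw [hA, Finset.mem_filter, Finset.mem_Icc] at hi hj
    have h := hgram u hu hen (E i) (E j) (t i) (t j) _ _ 1 1 (hEm i) (hEm j)
      Set.inter_subset_left Set.inter_subset_left hi.2 (htT i hi.1.1) hj.2 (htT j hj.1.1)
      (hEt i hi.1.1) (hEt j hj.1.1) (hs i) (hs j) (Real.sqrt_nonneg _) (Real.sqrt_nonneg _)
      zero_le_one zero_le_one
    rw [Real.sqrt_div (Nat.cast_nonneg i), Real.sqrt_div (Nat.cast_nonneg j), one_mul, one_mul,
      ← add_div, div_pow, Real.sq_sqrt hb.le, mul_div_cancel₀ _ hb.ne'] at h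
    linarith
  have hA0 : ∀ k ∈ A, 0 ≤ δ k := by
    intro k hk
    have h := hpair k hk k hk
    have e : √(k : ℝ) ^ 2 = k := Real.sq_sqrt (Nat.cast_nonneg k)
    simp only [hδ]
    nlinarith
  have hAgap : ∀ i ∈ A, ∀ j ∈ A, i < j →
      2 * (√(i : ℝ) * (√(j : ℝ) - √(i : ℝ))) ≤ 3 * δ i + δ j := by
    intro i hi j hj _
    have h := hpair i hi j hj
    have e1 : √(i : ℝ) ^ 2 = i := Real.sq_sqrt (Nat.cast_nonneg i)
    have e2 : √(j : ℝ) ^ 2 = j := Real.sq_sqrt (Nat.cast_nonneg j)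
    simp only [hδ]
    nlinarith
  have hterm : ∀ k ∈ Finset.Icc 1 n, ENNReal.ofReal (exp k) * hypVol (E k)
      = ENNReal.ofReal (exp k * t k) := by
    intro k hk
    rw [hEt k (Finset.mem_Icc.1 hk).1, ENNReal.ofReal_mul (exp_pos _).le]
  have ht0 : ∀ k, 0 ≤ t k := fun k => ENNReal.toReal_nonneg
  rw [Finset.sum_congr rfl hterm, ← ENNReal.ofReal_sum_of_nonneg
    fun k _ => mul_nonneg (exp_pos _).le (ht0 k)]
  refine ENNReal.ofReal_le_ofReal ?_
  calc ∑ k ∈ Finset.Icc 1 n, exp k * t k = ∑ k ∈ A, exp k * t k := by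
        refine (Finset.sum_filter_of_ne fun k _ hk => ?_).symm
        exact (ht0 k).lt_of_ne fun h => hk (by rw [← h, mul_zero])
    _ = ∑ k ∈ A, exp C₀ * exp (-δ k) := by
        refine Finset.sum_congr rfl fun k hk => ?_
        rw [hA, Finset.mem_filter] at hk
        rw [← exp_add]
        nth_rewrite 1 [← exp_log hk.2]
        rw [← exp_add]
        congr 1
        simp only [hδ, one_div, log_inv]
        ring
    _ ≤ exp C₀ * C₁ := by
        rw [← Finset.mul_sum]
        exact mul_le_mul_of_nonneg_left (hsum A δ hA0 hAgap) (exp_pos _).le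

theorem hardy_adams (α : ℝ) (hα : 0 < α) :
    ∃ C : ℝ, 0 < C ∧ ∀ u : E4 → ℝ, ContDiff ℝ (⊤ : ℕ∞) u → HasCompactSupport u →
      tsupport u ⊆ Metric.ball (0 : E4) 1 →
      (∫ x in Metric.ball (0 : E4) 1,
          (-(hypLap (fun y => -(hypLap u y) + α * u y) x)
            - (9 / 4) * (-(hypLap u x) + α * u x)) * u x * (2 / (1 - ‖x‖ ^ 2)) ^ 4) ≤ 1 →
      16 * (∫ x in Metric.ball (0 : E4) 1,
          (Real.exp (32 * π ^ 2 * u x ^ 2) - 1 - 32 * π ^ 2 * u x ^ 2)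
            / (1 - ‖x‖ ^ 2) ^ 4) ≤ C := by
  have hm : 0 < 9 / 4 + α := by linarith
  obtain ⟨C₂, hC₂, hsq⟩ := exists_lintegral_sq_le hm
  obtain ⟨C₁, hC₁, hsum⟩ := exists_sum_exp_mul_hypVol_le hm
  refine ⟨C₂ + exp 1 * C₁, by positivity, fun u hsmooth hcomp hsupp hen => ?_⟩
  have hu : IsBallTest u := ⟨hsmooth, hcomp, hsupp⟩
  rw [hu.energy_eq α] at hen
  have huc := hu.smooth.continuous
  have hum := huc.measurable
  obtain ⟨K, hK⟩ := huc.bounded_above_of_compact_support hu.compact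
  obtain ⟨n, hn⟩ := exists_nat_ge (32 * π ^ 2 * K ^ 2)
  have hNn : ∀ x, 32 * π ^ 2 * u x ^ 2 ≤ n := by
    intro x
    refine le_trans ?_ hn
    have h1 := hK x
    rw [Real.norm_eq_abs] at h1
    have h2 : u x ^ 2 ≤ K ^ 2 := by
      rw [← sq_abs]; exact pow_le_pow_left₀ (abs_nonneg _) h1 2
    gcongr
  have hG0 : ∀ x, 0 ≤ exp (32 * π ^ 2 * u x ^ 2) - 1 - 32 * π ^ 2 * u x ^ 2 := by
    intro x
    linarith [add_one_le_exp (32 * π ^ 2 * u x ^ 2)]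
  have hmeas : ∀ k : ℕ, MeasurableSet {x : E4 | (k : ℝ) ≤ 32 * π ^ 2 * u x ^ 2} := fun k =>
    measurableSet_le (by fun_prop) (by fun_prop)
  have hmain : ∫⁻ x, ENNReal.ofReal (exp (32 * π ^ 2 * u x ^ 2) - 1 - 32 * π ^ 2 * u x ^ 2) ∂hypVol
      ≤ ENNReal.ofReal (C₂ + exp 1 * C₁) := by
    have hpt : ∀ x, ENNReal.ofReal (exp (32 * π ^ 2 * u x ^ 2) - 1 - 32 * π ^ 2 * u x ^ 2)
        ≤ ENNReal.ofReal ((32 * π ^ 2 * u x ^ 2) ^ 2) + ∑ k ∈ Finset.Icc 1 n,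
          Set.indicator {x : E4 | (k : ℝ) ≤ 32 * π ^ 2 * u x ^ 2}
            (fun _ => ENNReal.ofReal (exp ((k : ℝ) + 1))) x := by
      intro x
      have h := exp_sub_one_sub_le_sum (N := 32 * π ^ 2 * u x ^ 2) (by positivity) (hNn x)
      refine (ENNReal.ofReal_le_ofReal h).trans ?_
      refine ENNReal.ofReal_add_le.trans (add_le_add le_rfl ?_)
      rw [ENNReal.ofReal_sum_of_nonneg fun k _ => by split_ifs <;> positivity]
      refine Finset.sum_le_sum fun k _ => le_of_eq ?_
      simp only [Set.indicator_apply, Set.mem_ofPred_eq]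
      split_ifs
      · rfl
      · exact ENNReal.ofReal_zero
    refine (lintegral_mono hpt).trans ?_
    rw [lintegral_add_left (by fun_prop), lintegral_finsetSum _ fun k _ =>
      measurable_const.indicator (hmeas k), ENNReal.ofReal_add hC₂.le (by positivity)]
    refine add_le_add (hsq u hu hen) ?_
    rw [ENNReal.ofReal_mul (exp_pos _).le]
    refine le_trans (le_of_eq ?_) (mul_le_mul_right (hsum u hu hen n) (ENNReal.ofReal (exp 1)))
    rw [Finset.mul_sum]
    refine Finset.sum_congr rfl fun k _ => ?_
    rw [lintegral_indicator_const (hmeas k), ← mul_assoc, ← ENNReal.ofReal_mul (exp_pos _).le,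
      ← exp_add, add_comm (1 : ℝ), Set.inter_comm]
    congr 1
    refine measure_congr ?_
    filter_upwards [ae_hypVol_mem_ball] with x hx
    exact propext ⟨fun h => ⟨h, hx⟩, fun h => h.1⟩
  have hrew : 16 * (∫ x in Metric.ball (0 : E4) 1,
        (exp (32 * π ^ 2 * u x ^ 2) - 1 - 32 * π ^ 2 * u x ^ 2) / (1 - ‖x‖ ^ 2) ^ 4)
      = ∫ x in Metric.ball (0 : E4) 1, (2 / ballDefect x) ^ 4
        * (exp (32 * π ^ 2 * u x ^ 2) - 1 - 32 * π ^ 2 * u x ^ 2) := by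
    rw [← integral_const_mul]
    refine integral_congr_ae (Filter.Eventually.of_forall fun x => ?_)
    simp only [ballDefect, div_pow]
    ring
  have hbd := measurable_ballDefect
  rw [hrew, integral_eq_lintegral_of_nonneg_ae
    (Filter.Eventually.of_forall fun x => mul_nonneg (by positivity) (hG0 x))
    (Measurable.aestronglyMeasurable (by fun_prop))]
  refine ENNReal.toReal_le_of_le_ofReal (by positivity) ?_
  rwa [lintegral_ofReal_hypVol (by fun_prop)] at hmain
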